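/- arXiv:1812.02680 — 3 statements merged into one kernel-verified Lean document; each statement's English description precedes it below -/
import Mathlib

section
/- Let H_{Φ,A} and H_{Ψ,B} be Hausdorff operators over the same measure space (Ω, μ) such that all matrices A(u) (u in the support of Φ) and B(v) (v in the support of Ψ) form one pairwise commuting family of real symmetric positive definite n×n matrices, and u ↦ |Φ(u)|(det A(u))^{-1/2} and v ↦ |Ψ(v)|(det B(v))^{-1/2} are μ-integrable. Let T_Φ and T_Ψ be continuous linear operators on L²(ℝⁿ;ℂ) realizing H_{Φ,A} and H_{Ψ,B} respectively, with symbols φ and ψ. Then there exists a linear isometric isomorphism V from L²(ℝⁿ;ℂ) onto L²(ℝⁿ;ℂ^{2^n}) such that for every f ∈ L², V((T_Φ ∘ T_Ψ) f)(s) = φ(s)ψ(s) • (Vf)(s) for a.e. s ∈ ℝⁿ; i.e., T_Φ T_Ψ is unitarily equivalent to multiplication by φψ. -/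
open MeasureTheory Complex Filter Matrix
open scoped ENNReal ComplexConjugate

section

open scoped FourierTransform RealInnerProductSpace SchwartzMap

theorem eLpNorm_two_eq_of_lintegral_sq_eq {X Y E F : Type*} [MeasurableSpace X] [MeasurableSpace Y]
    [NormedAddCommGroup E] [NormedAddCommGroup F] {ν : Measure X} {ρ : Measure Y}
    {f : X → E} {g : Y → F} (h : ∫⁻ x, ‖f x‖ₑ ^ 2 ∂ν = ∫⁻ y, ‖g y‖ₑ ^ 2 ∂ρ) :
    eLpNorm f 2 ν = eLpNorm g 2 ρ := by
  rw [eLpNorm_eq_lintegral_rpow_enorm_toReal (by simp) (by simp),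
    eLpNorm_eq_lintegral_rpow_enorm_toReal (by simp) (by simp)]
  simpa using congrArg (· ^ (2⁻¹ : ℝ)) h

theorem exists_linearIsometryEquiv_of_branches {X Y ι : Type*} [MeasurableSpace X]
    [MeasurableSpace Y] [Fintype ι] {ν : Measure X} {ρ : Measure Y}
    (θ : ι → X → Y) (hθ : ∀ k, Measurable (θ k))
    (w : X → ℝ) (hw : Measurable w) (hw0 : ∀ x, 0 < w x)
    (σ : Y → X) (hσ : Measurable σ) (hσθ : ∀ k x, σ (θ k x) = x)
    (S : ι → Set Y) (hS : ∀ k, MeasurableSet (S k)) (hSθ : ∀ j k x, θ k x ∈ S j ↔ j = k)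
    (hInt : ∀ h : Y → ℝ≥0∞, Measurable h →
      ∫⁻ y, h y ∂ρ = ∑ k, ∫⁻ x, h (θ k x) * ENNReal.ofReal (w x ^ 2) ∂ν) :
    (∀ k, Measure.QuasiMeasurePreserving (θ k) ν ρ) ∧
      ∃ U : Lp ℂ 2 ρ ≃ₗᵢ[ℂ] Lp (EuclideanSpace ℂ ι) 2 ν,
        ∀ f, ∀ᵐ x ∂ν, ∀ k, U f x k = (w x : ℂ) * f (θ k x) := by
  classical
  have hwe : ∀ x, ‖(w x : ℂ)‖ₑ ^ 2 = ENNReal.ofReal (w x ^ 2) := by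
    intro x
    rw [← ofReal_norm, Complex.norm_real, Real.norm_of_nonneg (hw0 x).le,
      ENNReal.ofReal_pow (hw0 x).le]
  have hqmp : ∀ k, Measure.QuasiMeasurePreserving (θ k) ν ρ := by
    intro k
    refine ⟨hθ k, Measure.AbsolutelyContinuous.mk fun N hN hN0 => ?_⟩
    rw [Measure.map_apply (hθ k) hN]
    have h1 := hInt (N.indicator 1) (measurable_one.indicator hN)
    rw [lintegral_indicator_one hN, hN0, eq_comm, Finset.sum_eq_zero_iff] at h1
    have h2 := h1 k (Finset.mem_univ k)
    have hm : Measurable fun x => N.indicator (1 : Y → ℝ≥0∞) (θ k x) * ENNReal.ofReal (w x ^ 2) :=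
      ((measurable_one.indicator hN).comp (hθ k)).mul (hw.pow_const 2).ennreal_ofReal
    rw [lintegral_eq_zero_iff hm] at h2
    rw [measure_eq_zero_iff_ae_notMem]
    filter_upwards [h2] with x hx hxN
    have hxN' : θ k x ∈ N := hxN
    simp [hxN'] at hx
    exact absurd hx (hw0 x).ne'
  let P : (Y → ℂ) → X → EuclideanSpace ℂ ι :=
    fun f x => WithLp.toLp 2 fun k => (w x : ℂ) * f (θ k x)
  have hPm : ∀ f, Measurable f → Measurable (P f) := by
    intro f hf
    refine (PiLp.continuous_toLp 2 _).measurable.comp (measurable_pi_lambda _ fun k => ?_)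
    exact (Complex.measurable_ofReal.comp hw).mul (hf.comp (hθ k))
  have hPn : ∀ f : Y → ℂ, Measurable f → eLpNorm (P f) 2 ν = eLpNorm f 2 ρ := by
    intro f hf
    refine eLpNorm_two_eq_of_lintegral_sq_eq ?_
    rw [hInt _ (hf.enorm.pow_const 2), ← lintegral_finsetSum]
    · refine lintegral_congr fun x => ?_
      rw [← ofReal_norm, ← ENNReal.ofReal_pow (norm_nonneg _), EuclideanSpace.norm_sq_eq,
        ENNReal.ofReal_sum_of_nonneg (fun _ _ => by positivity)]
      refine Finset.sum_congr rfl fun k _ => ?_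
      simp only [P, norm_mul, mul_pow]
      rw [ENNReal.ofReal_mul (by positivity), ENNReal.ofReal_pow (norm_nonneg _),
        ENNReal.ofReal_pow (norm_nonneg _), ofReal_norm, ofReal_norm, hwe, mul_comm]
    · intro k _
      exact ((hf.enorm.pow_const 2).comp (hθ k)).mul (hw.pow_const 2).ennreal_ofReal
  have hPmem : ∀ f : Y → ℂ, Measurable f → MemLp f 2 ρ → MemLp (P f) 2 ν := fun f hf h =>
    ⟨(hPm f hf).aestronglyMeasurable, by rw [hPn f hf]; exact h.2⟩
  have hLm : ∀ f : Lp ℂ 2 ρ, Measurable f := fun f => (Lp.stronglyMeasurable f).measurable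
  let L : Lp ℂ 2 ρ →ₗᵢ[ℂ] Lp (EuclideanSpace ℂ ι) 2 ν :=
    { toFun := fun f => (hPmem f (hLm f) (Lp.memLp f)).toLp
      map_add' := by
        intro f g
        rw [← MemLp.toLp_add]
        refine MemLp.toLp_congr _ _ ?_
        filter_upwards [ae_all_iff.2 fun k => (hqmp k).ae (Lp.coeFn_add f g)] with x hx
        ext k
        change (w x : ℂ) * (f + g : Lp ℂ 2 ρ) (θ k x) = w x * f (θ k x) + w x * g (θ k x)
        rw [hx k, Pi.add_apply, mul_add]
      map_smul' := by
        intro c f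
        rw [RingHom.id_apply, ← MemLp.toLp_const_smul]
        refine MemLp.toLp_congr _ _ ?_
        filter_upwards [ae_all_iff.2 fun k => (hqmp k).ae (Lp.coeFn_smul c f)] with x hx
        ext k
        change (w x : ℂ) * (c • f : Lp ℂ 2 ρ) (θ k x) = c * (w x * f (θ k x))
        rw [hx k, Pi.smul_apply, smul_eq_mul, mul_left_comm]
      norm_map' := by
        intro f
        simp only [LinearMap.coe_mk, AddHom.coe_mk]
        rw [Lp.norm_toLp, hPn _ (hLm f), Lp.norm_def] }
  have hL : ∀ f, L f =ᵐ[ν] P f := fun f =>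
    (hPmem f (hLm f) (Lp.memLp f)).coeFn_toLp
  have hsurj : Function.Surjective L := by
    intro G
    let g : Y → ℂ := fun y => ∑ j, (S j).indicator (fun y => (w (σ y) : ℂ)⁻¹ * G (σ y) j) y
    have hgm : Measurable g := by
      refine Finset.measurable_fun_sum _ fun j _ => Measurable.indicator ?_ (hS j)
      refine ((Complex.measurable_ofReal.comp (hw.comp hσ)).inv).mul ?_
      exact (((EuclideanSpace.proj j : EuclideanSpace ℂ ι →L[ℂ] ℂ).continuous.measurable).comp
        (Lp.stronglyMeasurable G).measurable).comp hσ
    have hPg : P g = G := by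
      ext x k
      have hw' : (w x : ℂ) ≠ 0 := by exact_mod_cast (hw0 x).ne'
      simp only [P, g, Set.indicator_apply, hSθ, hσθ, Finset.sum_ite_eq', Finset.mem_univ, if_true]
      rw [← mul_assoc, mul_inv_cancel₀ hw', one_mul]
    have hgmem : MemLp g 2 ρ := ⟨hgm.aestronglyMeasurable, by
      rw [← hPn g hgm, hPg]; exact Lp.eLpNorm_lt_top G⟩
    refine ⟨hgmem.toLp, Lp.ext ?_⟩
    filter_upwards [hL hgmem.toLp, ae_all_iff.2 fun k => (hqmp k).ae hgmem.coeFn_toLp] with x hx hx'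
    rw [hx, ← hPg]
    ext k
    simp [P, hx' k]
  refine ⟨hqmp, LinearIsometryEquiv.ofSurjective L hsurj, fun f => ?_⟩
  filter_upwards [hL f] with x hx k
  rw [LinearIsometryEquiv.coe_ofSurjective, hx]

theorem SchwartzMap.fourier_compSubConstCLM_apply {E F : Type*} [NormedAddCommGroup E]
    [MeasurableSpace E] [BorelSpace E]
    [NormedAddCommGroup F] [InnerProductSpace ℂ F] [CompleteSpace F]
    [InnerProductSpace ℝ E] [FiniteDimensional ℝ E] (l : E) (φ : 𝓢(E, F)) (ξ : E) :
    𝓕 (φ.compSubConstCLM ℂ l) ξ = Real.fourierChar (-⟪l, ξ⟫) • 𝓕 φ ξ := by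
  rw [SchwartzMap.fourier_coe, SchwartzMap.fourier_coe]
  have h := congrFun (VectorFourier.fourierIntegral_comp_add_right Real.fourierChar volume
    (innerₗ E) φ (-l)) ξ
  rw [map_neg, LinearMap.neg_apply, innerₗ_apply_apply] at h
  have h2 : (⇑φ ∘ fun v => v + -l) = φ.compSubConstCLM ℂ l := by
    ext v
    simp [sub_eq_add_neg]
  rw [h2] at h
  exact h

/-- Translation becomes modulation under the Fourier transform on `L²`. -/
theorem fourier_Lp_translate {E F : Type*} [NormedAddCommGroup E] [MeasurableSpace E] [BorelSpace E]
    [NormedAddCommGroup F] [InnerProductSpace ℂ F] [CompleteSpace F]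
    [InnerProductSpace ℝ E] [FiniteDimensional ℝ E] (l : E)
    (f g : Lp F 2 (volume : Measure E)) (hg : ∀ᵐ x, g x = f (x - l)) :
    ∀ᵐ ξ, (𝓕 g : Lp F 2 (volume : Measure E)) ξ =
      Real.fourierChar (-⟪l, ξ⟫) • (𝓕 f : Lp F 2 (volume : Measure E)) ξ := by
  have hm := measurePreserving_sub_right (volume : Measure E) l
  have hchar : Continuous fun ξ : E => ((Real.fourierChar (-⟪l, ξ⟫) : Circle) : ℂ) := by
    fun_prop
  have hmem : MemLp (fun ξ : E => ((Real.fourierChar (-⟪l, ξ⟫) : Circle) : ℂ)) ∞ :=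
    memLp_top_of_bound hchar.aestronglyMeasurable 1 (ae_of_all _ fun ξ => (Circle.norm_coe _).le)
  obtain ⟨M, hM⟩ : ∃ M : Lp F 2 (volume : Measure E) →L[ℂ] Lp F 2 (volume : Measure E),
      ∀ h : Lp F 2 (volume : Measure E), ∀ᵐ ξ, M h ξ = Real.fourierChar (-⟪l, ξ⟫) • h ξ := by
    refine ⟨(ContinuousLinearMap.lsmul ℂ ℂ).holderL volume ∞ 2 2 hmem.toLp, fun h => ?_⟩
    filter_upwards [(ContinuousLinearMap.lsmul ℂ ℂ).coeFn_holder (r := 2) hmem.toLp h,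
      hmem.coeFn_toLp] with ξ h1 h2
    change (ContinuousLinearMap.lsmul ℂ ℂ).holder 2 hmem.toLp h ξ = _
    rw [h1, h2]
    rfl
  obtain ⟨τ, hτc, hτ⟩ : ∃ τ : Lp F 2 (volume : Measure E) → Lp F 2 (volume : Measure E),
      Continuous τ ∧
      ∀ h : Lp F 2 (volume : Measure E), ∀ᵐ x, τ h x = h (x - l) :=
    ⟨Lp.compMeasurePreserving _ hm, (Lp.isometry_compMeasurePreserving hm).continuous,
      fun h => Lp.coeFn_compMeasurePreserving h hm⟩
  have hS : ∀ φ : 𝓢(E, F), (𝓕 (τ (φ.toLp 2)) : Lp F 2 (volume : Measure E)) = M (𝓕 (φ.toLp 2)) := by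
    intro φ
    have h0 : ∀ᵐ x, φ.toLp 2 volume x = φ x := φ.coeFn_toLp 2 volume
    have h1 : τ (φ.toLp 2) = (φ.compSubConstCLM ℂ l).toLp 2 := by
      refine Lp.ext ?_
      filter_upwards [hτ (φ.toLp 2), hm.quasiMeasurePreserving.ae h0,
        (φ.compSubConstCLM ℂ l).coeFn_toLp 2 volume] with x h1 h2 h3
      rw [h1, h2, h3]
      rfl
    rw [h1, SchwartzMap.toLp_fourier_eq, SchwartzMap.toLp_fourier_eq]
    refine Lp.ext ?_
    filter_upwards [hM ((𝓕 φ).toLp 2), (𝓕 φ).coeFn_toLp 2 volume,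
      (𝓕 (φ.compSubConstCLM ℂ l)).coeFn_toLp 2 volume] with ξ h1 h2 h3
    rw [h1, h2, h3, SchwartzMap.fourier_compSubConstCLM_apply]
  have key : (𝓕 (τ f) : Lp F 2 (volume : Measure E)) = M (𝓕 f) := by
    have h1 : Continuous fun h => (𝓕 (τ h) : Lp F 2 (volume : Measure E)) :=
      (Lp.fourierTransformₗᵢ E F).continuous.comp hτc
    have h2 : Continuous fun h : Lp F 2 (volume : Measure E) =>
        M (𝓕 h : Lp F 2 (volume : Measure E)) :=
      M.continuous.comp (Lp.fourierTransformₗᵢ E F).continuous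
    exact congrFun ((SchwartzMap.denseRange_toLpCLM (F := F) (p := 2) (μ := (volume : Measure E))
      ENNReal.ofNat_ne_top).equalizer h1 h2 (funext hS)) f
  have hgτ : g = τ f := by
    refine Lp.ext ?_
    filter_upwards [hg, hτ f] with x h1 h2
    rw [h1, h2]
  rw [hgτ, key]
  exact hM _

/-- The sign `±1` attached to the `j`-th entry of a Boolean vector. -/
def boolSign {n : ℕ} (k : Fin n → Bool) (j : Fin n) : ℝ := if k j then 1 else -1

theorem boolSign_mul_self {n : ℕ} (k : Fin n → Bool) (j : Fin n) :
    boolSign k j * boolSign k j = 1 := by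
  unfold boolSign; split_ifs <;> norm_num

theorem abs_boolSign {n : ℕ} (k : Fin n → Bool) (j : Fin n) : |boolSign k j| = 1 := by
  unfold boolSign; split_ifs <;> norm_num

/-- Exponential coordinates on the open orthant with signs `k`. -/
noncomputable def orthantExp {n : ℕ} (k : Fin n → Bool) (x : Fin n → ℝ) : Fin n → ℝ :=
  fun j => boolSign k j * Real.exp (-(2 * Real.pi) * x j)

/-- The open orthant with signs `k`. -/
def orthant {n : ℕ} (k : Fin n → Bool) : Set (Fin n → ℝ) := {y | ∀ j, 0 < boolSign k j * y j}

theorem measurableSet_orthant {n : ℕ} (k : Fin n → Bool) : MeasurableSet (orthant k) := by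
  rw [orthant, Set.ofPred_forall]
  exact MeasurableSet.iInter fun j =>
    measurableSet_lt measurable_const ((measurable_pi_apply j).const_mul _)

theorem measurable_orthantExp {n : ℕ} (k : Fin n → Bool) : Measurable (orthantExp k) :=
  measurable_pi_lambda _ fun j =>
    (Real.measurable_exp.comp ((measurable_pi_apply j).const_mul _)).const_mul _

theorem log_abs_orthantExp {n : ℕ} (k : Fin n → Bool) (x : Fin n → ℝ) (j : Fin n) :
    Real.log |orthantExp k x j| = -(2 * Real.pi) * x j := by
  rw [orthantExp, abs_mul, abs_boolSign, one_mul, Real.abs_exp, Real.log_exp]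

theorem orthantExp_injective {n : ℕ} (k : Fin n → Bool) : Function.Injective (orthantExp k) := by
  intro x y h
  ext j
  have h1 := log_abs_orthantExp k x j
  rw [h, log_abs_orthantExp] at h1
  have : (2 * Real.pi) ≠ 0 := by positivity
  simpa [this, Real.pi_ne_zero] using h1.symm

theorem orthantExp_mem_orthant_iff {n : ℕ} (j k : Fin n → Bool) (x : Fin n → ℝ) :
    orthantExp k x ∈ orthant j ↔ j = k := by
  constructor
  · intro h
    ext i
    have h1 := h i
    rw [orthantExp, ← mul_assoc, mul_pos_iff_of_pos_right (Real.exp_pos _)] at h1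
    unfold boolSign at h1
    cases hj : j i <;> cases hk : k i <;> simp [hj, hk] at h1 ⊢ <;> linarith
  · rintro rfl i
    rw [orthantExp, ← mul_assoc, boolSign_mul_self, one_mul]
    exact Real.exp_pos _

theorem range_orthantExp {n : ℕ} (k : Fin n → Bool) : Set.range (orthantExp k) = orthant k := by
  ext y
  constructor
  · rintro ⟨x, rfl⟩
    exact (orthantExp_mem_orthant_iff k k x).2 rfl
  · intro h
    refine ⟨fun j => -(Real.log (boolSign k j * y j)) / (2 * Real.pi), ?_⟩
    ext j
    have hp : (2 * Real.pi) ≠ 0 := by positivity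
    have : -(2 * Real.pi) * (-(Real.log (boolSign k j * y j)) / (2 * Real.pi)) =
        Real.log (boolSign k j * y j) := by field_simp
    rw [orthantExp, this, Real.exp_log (h j), ← mul_assoc, boolSign_mul_self, one_mul]

theorem pairwise_disjoint_orthant {n : ℕ} :
    Pairwise (Function.onFun Disjoint (orthant (n := n))) := by
  intro j k hjk
  rw [Function.onFun, Set.disjoint_left]
  intro y hj hk
  rw [← range_orthantExp] at hk
  obtain ⟨x, rfl⟩ := hk
  exact hjk ((orthantExp_mem_orthant_iff j k x).1 hj)

theorem ae_mem_iUnion_orthant (n : ℕ) :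
    ∀ᵐ y : Fin n → ℝ, y ∈ ⋃ k, orthant k := by
  have h : ∀ j : Fin n, ∀ᵐ y : Fin n → ℝ, y j ≠ 0 := fun j =>
    (measure_eq_zero_iff_ae_notMem (s := {y : Fin n → ℝ | y j = 0})).1
      (Measure.pi_hyperplane (fun _ : Fin n => (volume : Measure ℝ)) j 0)
  filter_upwards [ae_all_iff.2 h] with y hy
  refine Set.mem_iUnion.2 ⟨fun j => decide (0 < y j), fun j => ?_⟩
  unfold boolSign
  by_cases hj : 0 < y j
  · simp [hj]
  · have := lt_of_le_of_ne (not_lt.1 hj) (hy j)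
    simpa [hj] using this

theorem lintegral_orthant {n : ℕ} (k : Fin n → Bool) (h : (Fin n → ℝ) → ℝ≥0∞) :
    ∫⁻ y in orthant k, h y = ∫⁻ x, h (orthantExp k x) *
      ENNReal.ofReal ((2 * Real.pi) ^ n * Real.exp (-(2 * Real.pi) * ∑ j, x j)) := by
  let c : (Fin n → ℝ) → Fin n → ℝ := fun x j =>
    boolSign k j * (Real.exp (-(2 * Real.pi) * x j) * -(2 * Real.pi))
  let D : (Fin n → ℝ) → (Fin n → ℝ) →L[ℝ] (Fin n → ℝ) := fun x =>
    ContinuousLinearMap.pi fun j =>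
      (ContinuousLinearMap.toSpanSingleton ℝ (c x j)).comp (ContinuousLinearMap.proj j)
  have hD : ∀ x, HasFDerivAt (orthantExp k) (D x) x := by
    intro x
    refine hasFDerivAt_pi.2 fun j => ?_
    have h1 : HasDerivAt (fun t : ℝ => boolSign k j * Real.exp (-(2 * Real.pi) * t)) (c x j)
        (x j) := by
      have := ((hasDerivAt_id (x j)).const_mul (-(2 * Real.pi))).exp.const_mul (boolSign k j)
      simpa [c] using this
    have h2 : HasFDerivAt (fun x : Fin n → ℝ => x j) (ContinuousLinearMap.proj j) x :=
      (ContinuousLinearMap.proj (R := ℝ) (φ := fun _ : Fin n => ℝ) j).hasFDerivAt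
    have h3 := HasFDerivAt.comp x h1.hasFDerivAt h2
    exact h3
  have hdet : ∀ x, |(D x).det| = (2 * Real.pi) ^ n * Real.exp (-(2 * Real.pi) * ∑ j, x j) := by
    intro x
    have h1 : (D x).det = ∏ j, c x j := by
      rw [ContinuousLinearMap.det_pi]
      refine Finset.prod_congr rfl fun j _ => ?_
      simp [ContinuousLinearMap.det]
    have h2 : ∀ j, |c x j| = 2 * Real.pi * Real.exp (-(2 * Real.pi) * x j) := by
      intro j
      rw [abs_mul, abs_boolSign, abs_mul, Real.abs_exp, abs_neg, abs_of_pos (by positivity)]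
      ring
    rw [h1, Finset.abs_prod, Finset.prod_congr rfl fun j _ => h2 j, Finset.prod_mul_distrib,
      ← Real.exp_sum, Finset.mul_sum]
    simp
  have := lintegral_image_eq_lintegral_abs_det_fderiv_mul volume MeasurableSet.univ
    (fun x _ => (hD x).hasFDerivWithinAt) (orthantExp_injective k).injOn h
  rw [Set.image_univ, range_orthantExp, Measure.restrict_univ] at this
  rw [this]
  refine lintegral_congr fun x => ?_
  rw [hdet, mul_comm]

theorem lintegral_eq_sum_orthantExp {n : ℕ} (h : (Fin n → ℝ) → ℝ≥0∞) :
    ∫⁻ y, h y = ∑ k, ∫⁻ x, h (orthantExp k x) *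
      ENNReal.ofReal ((2 * Real.pi) ^ n * Real.exp (-(2 * Real.pi) * ∑ j, x j)) := by
  rw [← Measure.restrict_eq_self_of_ae_mem (ae_mem_iUnion_orthant n),
    lintegral_iUnion measurableSet_orthant pairwise_disjoint_orthant, tsum_fintype,
    Measure.restrict_eq_self_of_ae_mem (ae_mem_iUnion_orthant n)]
  exact Finset.sum_congr rfl fun k _ => lintegral_orthant k h

theorem orthantExp_sub_log {n : ℕ} (k : Fin n → Bool) (x a : Fin n → ℝ) (ha : ∀ j, 0 < a j) :
    orthantExp k (fun j => x j - Real.log (a j) / (2 * Real.pi)) =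
      Matrix.diagonal a *ᵥ orthantExp k x := by
  ext j
  have hp : (2 * Real.pi) ≠ 0 := by positivity
  have : -(2 * Real.pi) * (x j - Real.log (a j) / (2 * Real.pi)) =
      Real.log (a j) + -(2 * Real.pi) * x j := by field_simp; ring
  rw [Matrix.mulVec_diagonal, orthantExp, this, Real.exp_add, Real.exp_log (ha j), orthantExp]
  ring

theorem exists_linearIsometryEquiv_comp_measurableEquiv {X Y H : Type*} [MeasurableSpace X]
    [MeasurableSpace Y] [NormedAddCommGroup H] [NormedSpace ℂ H] {ν : Measure X} {ρ : Measure Y}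
    (σ : X ≃ᵐ Y) (hσ : MeasurePreserving σ ν ρ) :
    ∃ W : Lp H 2 ρ ≃ₗᵢ[ℂ] Lp H 2 ν, ∀ f, ∀ᵐ x ∂ν, W f x = f (σ x) := by
  have hσ' : MeasurePreserving σ.symm ρ ν := hσ.symm σ
  have hsurj : Function.Surjective
      (Lp.compMeasurePreservingₗᵢ ℂ σ hσ : Lp H 2 ρ →ₗᵢ[ℂ] Lp H 2 ν) := by
    intro g
    refine ⟨Lp.compMeasurePreserving σ.symm hσ' g, Lp.ext ?_⟩
    filter_upwards [Lp.coeFn_compMeasurePreserving (Lp.compMeasurePreserving σ.symm hσ' g) hσ,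
      hσ.quasiMeasurePreserving.ae (Lp.coeFn_compMeasurePreserving g hσ')] with x h1 h2
    refine h1.trans ?_
    rw [Function.comp_apply, h2, Function.comp_apply, σ.symm_apply_apply]
  exact ⟨LinearIsometryEquiv.ofSurjective _ hsurj, fun f => Lp.coeFn_compMeasurePreserving f hσ⟩

theorem measurePreserving_mulVec_of_mul_transpose_eq_one {n : ℕ} {C : Matrix (Fin n) (Fin n) ℝ}
    (hC : C * Cᵀ = 1) : MeasurePreserving (fun x : Fin n → ℝ => C⁻¹ *ᵥ x) := by
  have hdet : |C⁻¹.det| = 1 := by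
    have h1 : C.det * C.det = 1 := by
      simpa using congrArg Matrix.det hC
    have h2 : |C.det| = 1 := by
      rcases mul_self_eq_one_iff.1 h1 with h | h <;> simp [h]
    rw [Matrix.det_nonsing_inv, Ring.inverse_eq_inv', abs_inv, h2, inv_one]
  have h0 : C⁻¹.det ≠ 0 := fun h => by simp [h] at hdet
  refine ⟨(Continuous.matrix_mulVec continuous_const continuous_id).measurable, ?_⟩
  have := Real.map_matrix_volume_pi_eq_smul_volume_pi h0
  have h : ⇑(Matrix.toLin' C⁻¹) = fun x => C⁻¹ *ᵥ x := funext fun x => Matrix.toLin'_apply _ _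
  rw [abs_inv, hdet, h] at this
  simpa using this

/-- The Mellin-type transform diagonalizing all substitutions by matrices `C⁻¹ diag(a) C`. -/
theorem exists_mellin_linearIsometryEquiv {n : ℕ} {C : Matrix (Fin n) (Fin n) ℝ}
    (hC : C * Cᵀ = 1) :
    ∃ V : Lp ℂ 2 (volume : Measure (Fin n → ℝ)) ≃ₗᵢ[ℂ]
        Lp (EuclideanSpace ℂ (Fin (2 ^ n))) 2 (volume : Measure (Fin n → ℝ)),
      ∀ a : Fin n → ℝ, (∀ j, 0 < a j) → ∀ f g : Lp ℂ 2 (volume : Measure (Fin n → ℝ)),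
        (∀ᵐ x, g x = f ((C⁻¹ * Matrix.diagonal a * C) *ᵥ x)) →
        ∀ᵐ s, V g s =
          (∏ j, (a j : ℂ) ^ (-(1 / 2 : ℂ) - Complex.I * (s j : ℂ))) • V f s := by
  let H := EuclideanSpace ℂ (Fin (2 ^ n))
  let E := EuclideanSpace ℝ (Fin n)
  have hCu : IsUnit C.det := (Matrix.isUnit_iff_isUnit_det C).1 (IsUnit.of_mul_eq_one _ hC)
  have hCC : ∀ y : Fin n → ℝ, C *ᵥ (C⁻¹ *ᵥ y) = y := fun y => by
    rw [Matrix.mulVec_mulVec, Matrix.mul_nonsing_inv _ hCu, Matrix.one_mulVec]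
  have hCm : Measurable fun y : Fin n → ℝ => C *ᵥ y :=
    (Continuous.matrix_mulVec continuous_const continuous_id).measurable
  have hCp := measurePreserving_mulVec_of_mul_transpose_eq_one hC
  let σE : (Fin n → ℝ) ≃ᵐ E := MeasurableEquiv.toLp 2 (Fin n → ℝ)
  have hσE : MeasurePreserving σE := PiLp.volume_preserving_toLp (Fin n)
  have hEm : Measurable fun x : E => x.ofLp := σE.symm.measurable
  let q : Fin (2 ^ n) ≃ (Fin n → Bool) := Fintype.equivOfCardEq (by simp)
  let θ : Fin (2 ^ n) → E → (Fin n → ℝ) := fun k x => C⁻¹ *ᵥ orthantExp (q k) x.ofLp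
  have hθ : ∀ k, Measurable (θ k) := fun k =>
    hCp.measurable.comp ((measurable_orthantExp (q k)).comp hEm)
  let w : E → ℝ := fun x => Real.sqrt ((2 * Real.pi) ^ n) * Real.exp (-Real.pi * ∑ j, x j)
  have hw : Measurable w :=
    (Real.measurable_exp.comp ((Finset.measurable_sum _ fun j _ =>
      (measurable_pi_apply j).comp hEm).const_mul _)).const_mul _
  have hw0 : ∀ x, 0 < w x := fun x => by positivity
  have hw2 : ∀ x : E, w x ^ 2 = (2 * Real.pi) ^ n * Real.exp (-(2 * Real.pi) * ∑ j, x j) := by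
    intro x
    rw [mul_pow, Real.sq_sqrt (by positivity), ← Real.exp_nat_mul]
    congr 2
    push_cast
    ring
  have hInt : ∀ h : (Fin n → ℝ) → ℝ≥0∞, Measurable h →
      ∫⁻ y, h y = ∑ k, ∫⁻ x, h (θ k x) * ENNReal.ofReal (w x ^ 2) := by
    intro h hh
    rw [← hCp.lintegral_comp hh, lintegral_eq_sum_orthantExp, ← q.sum_comp]
    refine Finset.sum_congr rfl fun k _ => ?_
    have hm : Measurable fun x : E => h (θ k x) * ENNReal.ofReal (w x ^ 2) :=
      (hh.comp (hθ k)).mul (hw.pow_const 2).ennreal_ofReal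
    rw [← hσE.lintegral_comp hm]
    simp only [hw2]
    rfl
  have hp : (2 * Real.pi) ≠ 0 := by positivity
  obtain ⟨hqmp, U, hU⟩ := exists_linearIsometryEquiv_of_branches θ hθ w hw hw0
    (fun y => σE fun j => Real.log |(C *ᵥ y) j| / -(2 * Real.pi))
    (σE.measurable.comp (measurable_pi_lambda _ fun j =>
      (Real.measurable_log.comp (((measurable_pi_apply j).comp hCm).abs)).div_const _))
    (by
      intro k x
      ext j
      change Real.log |(C *ᵥ (C⁻¹ *ᵥ orthantExp (q k) x.ofLp)) j| / -(2 * Real.pi) = x.ofLp j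
      rw [hCC, log_abs_orthantExp, mul_div_cancel_left₀ _ (neg_ne_zero.2 hp)])
    (fun k => (fun y => C *ᵥ y) ⁻¹' orthant (q k))
    (fun k => hCm (measurableSet_orthant _))
    (by
      intro j k x
      change C *ᵥ (C⁻¹ *ᵥ orthantExp (q k) x.ofLp) ∈ orthant (q j) ↔ j = k
      rw [hCC, orthantExp_mem_orthant_iff, q.injective.eq_iff])
    hInt
  obtain ⟨W, hW⟩ := exists_linearIsometryEquiv_comp_measurableEquiv (H := H) σE hσE
  refine ⟨(U.trans (Lp.fourierTransformₗᵢ E H)).trans W, fun a ha f g hg => ?_⟩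
  let l : E := WithLp.toLp 2 fun j => Real.log (a j) / (2 * Real.pi)
  let c : ℝ := Real.exp (-Real.pi * ∑ j, l j)
  have hcw : ∀ x : E, w x = c * w (x - l) := by
    intro x
    have hs : ∑ j, (x - l) j = ∑ j, x j - ∑ j, l j := by
      rw [← Finset.sum_sub_distrib]
      rfl
    simp only [w, c]
    rw [hs, mul_left_comm, ← Real.exp_add]
    ring_nf
  have hθl : ∀ k (x : E), (C⁻¹ * Matrix.diagonal a * C) *ᵥ θ k x = θ k (x - l) := by
    intro k x
    have h1 := orthantExp_sub_log (q k) x.ofLp a ha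
    change _ = C⁻¹ *ᵥ orthantExp (q k) (fun j => x.ofLp j - Real.log (a j) / (2 * Real.pi))
    rw [h1, ← Matrix.mulVec_mulVec, ← Matrix.mulVec_mulVec, hCC]
  have hc0 : (c : ℂ) ≠ 0 := by exact_mod_cast (Real.exp_pos _).ne'
  have htrans : ∀ᵐ x : E, ((c : ℂ)⁻¹ • U g : Lp H 2 (volume : Measure E)) x = U f (x - l) := by
    filter_upwards [Lp.coeFn_smul (c : ℂ)⁻¹ (U g), hU g,
      (measurePreserving_sub_right (volume : Measure E) l).quasiMeasurePreserving.ae (hU f),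
      ae_all_iff.2 fun k => (hqmp k).ae hg] with x h1 h2 h3 h4
    rw [h1]
    ext k
    rw [Pi.smul_apply, PiLp.smul_apply, h2, h3, h4, hθl, hcw, smul_eq_mul]
    push_cast
    field_simp
  have hF := fourier_Lp_translate l (U f) ((c : ℂ)⁻¹ • U g) htrans
  have hF' : ∀ᵐ ξ : E, Lp.fourierTransformₗᵢ E H (U g) ξ =
      ((c : ℂ) * Real.fourierChar (-⟪l, ξ⟫)) • Lp.fourierTransformₗᵢ E H (U f) ξ := by
    have h0 : Lp.fourierTransformₗᵢ E H (U g) =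
        (c : ℂ) • Lp.fourierTransformₗᵢ E H ((c : ℂ)⁻¹ • U g) := by
      rw [map_smul, smul_smul, mul_inv_cancel₀ hc0, one_smul]
    rw [h0]
    filter_upwards [hF, Lp.coeFn_smul (c : ℂ) (Lp.fourierTransformₗᵢ E H ((c : ℂ)⁻¹ • U g))]
      with ξ h1 h2
    rw [h2, Pi.smul_apply, mul_smul]
    congr 1
  filter_upwards [hW (Lp.fourierTransformₗᵢ E H (U g)), hW (Lp.fourierTransformₗᵢ E H (U f)),
    hσE.quasiMeasurePreserving.ae hF'] with s h1 h2 h3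
  change W (Lp.fourierTransformₗᵢ E H (U g)) s =
    _ • W (Lp.fourierTransformₗᵢ E H (U f)) s
  rw [h1, h2, h3]
  congr 1
  have hchar : ((Real.fourierChar (-⟪l, σE s⟫) : Circle) : ℂ) =
      Complex.exp (∑ j, -(Complex.I * s j * Real.log (a j))) := by
    have hin : ⟪l, σE s⟫ = ∑ j, Real.log (a j) / (2 * Real.pi) * s j := by
      rw [PiLp.inner_apply]
      exact Finset.sum_congr rfl fun j _ => mul_comm _ _
    rw [Real.fourierChar_apply, hin]
    congr 1
    push_cast
    rw [← Finset.sum_neg_distrib, Finset.mul_sum, Finset.sum_mul]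
    refine Finset.sum_congr rfl fun j _ => ?_
    have : (Real.pi : ℂ) ≠ 0 := by exact_mod_cast Real.pi_ne_zero
    field_simp
  have hcc : (c : ℂ) = Complex.exp (∑ j, -(1 / 2 * (Real.log (a j) : ℂ))) := by
    rw [Complex.ofReal_exp]
    congr 1
    push_cast
    rw [Finset.mul_sum]
    refine Finset.sum_congr rfl fun j _ => ?_
    have : (Real.pi : ℂ) ≠ 0 := by exact_mod_cast Real.pi_ne_zero
    simp only [l]
    push_cast
    field_simp
  rw [hchar, hcc, ← Complex.exp_add, ← Finset.sum_add_distrib, Complex.exp_sum]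
  refine Finset.prod_congr rfl fun j _ => ?_
  rw [Complex.cpow_def_of_ne_zero (by exact_mod_cast (ha j).ne'), ← Complex.ofReal_log (ha j).le]
  congr 1
  ring

theorem integral_norm_mul_le_of_Lp_two {X : Type*} [MeasurableSpace X] {ν : Measure X}
    (f g : Lp ℂ 2 ν) :
    Integrable (fun x => f x * g x) ν ∧ ∫ x, ‖f x * g x‖ ∂ν ≤ ‖f‖ * ‖g‖ := by
  let h : Lp ℂ 1 ν := f • g
  have hh : h =ᵐ[ν] fun x => f x * g x := Lp.coeFn_lpSMul f g
  refine ⟨(L1.integrable_coeFn h).congr hh, ?_⟩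
  calc ∫ x, ‖f x * g x‖ ∂ν = ∫ x, ‖h x‖ ∂ν :=
        integral_congr_ae (by filter_upwards [hh] with x hx; rw [hx])
    _ = ‖h‖ := (L1.norm_eq_integral_norm h).symm
    _ ≤ ‖f‖ * ‖g‖ := Lp.norm_smul_le f g

/-- If `V` turns every substitution operator `f ↦ f ∘ m u` into multiplication by `e u`, it turns
the average of these operators with weight `Φ` into multiplication by the average of the `e u`. -/
theorem intertwines_integral_of_intertwines {Ω X Y H : Type*} [MeasurableSpace Ω]
    [MeasurableSpace X] [MeasurableSpace Y] [NormedAddCommGroup H] [InnerProductSpace ℂ H]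
    {μ : Measure Ω} {ν : Measure X} {ρ : Measure Y} [SigmaFinite μ] [SigmaFinite ν] [SigmaFinite ρ]
    (V : Lp ℂ 2 ν ≃ₗᵢ[ℂ] Lp H 2 ρ)
    (m : Ω → X → X) (hm : Measurable (Function.uncurry m))
    (hmem : ∀ u (f : Lp ℂ 2 ν), MemLp (fun x => f (m u x)) 2 ν)
    (e : Ω → Y → ℂ) (he : Measurable (Function.uncurry e))
    (c : Ω → ℝ) (hc : ∀ u y, ‖e u y‖ = c u)
    (hV : ∀ u (f g : Lp ℂ 2 ν), (∀ᵐ x ∂ν, g x = f (m u x)) → ∀ᵐ y ∂ρ, V g y = e u y • V f y)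
    (Φ : Ω → ℂ) (hΦ : StronglyMeasurable Φ) (hInt : Integrable (fun u => ‖Φ u‖ * c u) μ)
    (f g : Lp ℂ 2 ν) (hg : ∀ᵐ x ∂ν, g x = ∫ u, Φ u * f (m u x) ∂μ) :
    ∀ᵐ y ∂ρ, V g y = (∫ u, Φ u * e u y ∂μ) • V f y := by
  have hΦ1 : Measurable fun p : Ω × Y => Φ p.1 := hΦ.measurable.comp measurable_fst
  let φ : Y → ℂ := fun y => ∫ u, Φ u * e u y ∂μ
  have hφm : StronglyMeasurable φ := by
    refine StronglyMeasurable.integral_prod_left (f := fun u y => Φ u * e u y) ?_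
    exact (hΦ1.mul he).stronglyMeasurable
  have hφb : ∀ y, ‖φ y‖ ≤ ∫ u, ‖Φ u‖ * c u ∂μ := fun y =>
    norm_integral_le_of_norm_le hInt (ae_of_all _ fun u => by rw [norm_mul, hc])
  have hh : MemLp (fun y => φ y • V f y) 2 ρ := by
    refine MemLp.of_le_mul (c := ∫ u, ‖Φ u‖ * c u ∂μ) (Lp.memLp (V f))
      (hφm.smul (Lp.stronglyMeasurable (V f))).aestronglyMeasurable (ae_of_all _ fun y => ?_)
    rw [norm_smul]
    gcongr
    exact hφb y
  let D : Ω → Lp ℂ 2 ν := fun u => (hmem u f).toLp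
  have hD : ∀ u, ∀ᵐ x ∂ν, D u x = f (m u x) := fun u => (hmem u f).coeFn_toLp
  have hDn : ∀ u, ‖D u‖ ≤ c u * ‖f‖ := by
    intro u
    rw [← V.norm_map (D u), ← V.norm_map f]
    refine Lp.norm_le_mul_norm_of_ae_le_mul ?_
    filter_upwards [hV u f (D u) (hD u)] with y hy
    rw [hy, norm_smul, hc]
  obtain ⟨h, hhφ⟩ : ∃ h : Lp H 2 ρ, ∀ᵐ y ∂ρ, h y = φ y • V f y := ⟨hh.toLp, hh.coeFn_toLp⟩
  have key : V g = h := by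
    refine ext_inner_left ℂ fun v => ?_
    obtain ⟨K, rfl⟩ := V.surjective v
    rw [V.inner_map_map, L2.inner_def, L2.inner_def]
    have hKs : StronglyMeasurable fun x => conj (K x) :=
      RCLike.continuous_conj.comp_stronglyMeasurable (Lp.stronglyMeasurable K)
    have hKmem : MemLp (fun x => conj (K x)) 2 ν :=
      (Lp.memLp K).of_le hKs.aestronglyMeasurable (ae_of_all _ fun x => by simp)
    let K' : Lp ℂ 2 ν := hKmem.toLp
    have hK' : ∀ᵐ x ∂ν, K' x = conj (K x) := hKmem.coeFn_toLp
    have hslice : ∀ u, ∀ᵐ x ∂ν, Φ u * f (m u x) * conj (K x) = Φ u * (D u x * K' x) := by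
      intro u
      filter_upwards [hD u, hK'] with x h1 h2
      rw [h1, h2, mul_assoc]
    have hF : Integrable (Function.uncurry fun u x => Φ u * f (m u x) * conj (K x)) (μ.prod ν) := by
      have hsm : StronglyMeasurable
          (Function.uncurry fun u x => Φ u * f (m u x) * conj (K x)) :=
        ((hΦ.comp_measurable measurable_fst).mul
          ((Lp.stronglyMeasurable f).comp_measurable hm)).mul (hKs.comp_measurable measurable_snd)
      refine (integrable_prod_iff hsm.aestronglyMeasurable).2 ⟨ae_of_all _ fun u => ?_, ?_⟩
      · exact ((integral_norm_mul_le_of_Lp_two (D u) K').1.const_mul (Φ u)).congr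
          (by filter_upwards [hslice u] with x hx using hx.symm)
      · refine (hInt.mul_const (‖f‖ * ‖K'‖)).mono'
          hsm.norm.integral_prod_right'.aestronglyMeasurable (ae_of_all _ fun u => ?_)
        rw [Real.norm_of_nonneg (integral_nonneg fun _ => norm_nonneg _)]
        calc ∫ x, ‖Φ u * f (m u x) * conj (K x)‖ ∂ν
            = ∫ x, ‖Φ u‖ * ‖D u x * K' x‖ ∂ν := integral_congr_ae (by
              filter_upwards [hslice u] with x hx
              rw [hx, norm_mul])
          _ = ‖Φ u‖ * ∫ x, ‖D u x * K' x‖ ∂ν := integral_const_mul _ _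
          _ ≤ ‖Φ u‖ * ((c u * ‖f‖) * ‖K'‖) := by
              gcongr
              exact (integral_norm_mul_le_of_Lp_two (D u) K').2.trans
                (mul_le_mul_of_nonneg_right (hDn u) (norm_nonneg _))
          _ = ‖Φ u‖ * c u * (‖f‖ * ‖K'‖) := by ring
    have hG : Integrable (Function.uncurry fun u y => Φ u * e u y * inner ℂ (V K y) (V f y))
        (μ.prod ρ) := by
      refine (hInt.mul_prod (L2.integrable_inner (𝕜 := ℂ) (V K) (V f)).norm).mono' ?_
        (ae_of_all _ fun p => ?_)
      · exact ((hΦ1.mul he).stronglyMeasurable.mul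
          (((Lp.stronglyMeasurable (V K)).inner (Lp.stronglyMeasurable (V f))).comp_measurable
            measurable_snd)).aestronglyMeasurable
      · simp only [Function.uncurry, norm_mul, hc]
        rfl
    calc ∫ x, inner ℂ (K x) (g x) ∂ν
        = ∫ x, ∫ u, Φ u * f (m u x) * conj (K x) ∂μ ∂ν := integral_congr_ae (by
          filter_upwards [hg] with x hx
          rw [RCLike.inner_apply, hx, integral_mul_const])
      _ = ∫ u, ∫ x, Φ u * f (m u x) * conj (K x) ∂ν ∂μ := (integral_integral_swap hF).symm
      _ = ∫ u, ∫ y, Φ u * e u y * inner ℂ (V K y) (V f y) ∂ρ ∂μ := by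
          refine integral_congr_ae (ae_of_all _ fun u => ?_)
          calc ∫ x, Φ u * f (m u x) * conj (K x) ∂ν = ∫ x, Φ u * inner ℂ (K x) (D u x) ∂ν :=
                integral_congr_ae (by
                  filter_upwards [hD u] with x hx
                  rw [hx, RCLike.inner_apply, mul_assoc])
            _ = Φ u * inner ℂ K (D u) := by rw [integral_const_mul, L2.inner_def]
            _ = Φ u * inner ℂ (V K) (V (D u)) := by rw [V.inner_map_map]
            _ = Φ u * ∫ y, inner ℂ (V K y) (V (D u) y) ∂ρ := by rw [L2.inner_def]
            _ = ∫ y, Φ u * e u y * inner ℂ (V K y) (V f y) ∂ρ := by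
                rw [← integral_const_mul]
                refine integral_congr_ae ?_
                filter_upwards [hV u f (D u) (hD u)] with y hy
                rw [hy, inner_smul_right, mul_assoc]
      _ = ∫ y, ∫ u, Φ u * e u y * inner ℂ (V K y) (V f y) ∂μ ∂ρ := integral_integral_swap hG
      _ = ∫ y, inner ℂ (V K y) (h y) ∂ρ := integral_congr_ae (by
          filter_upwards [hhφ] with y hy
          rw [hy, inner_smul_right, integral_mul_const])
  rw [key]
  exact hhφ

theorem ae_integral_mul_eq_zero_of_not_aestronglyMeasurable {Ω X : Type*} [MeasurableSpace Ω]
    [MeasurableSpace X] {μ : Measure Ω} {ν : Measure X} [SFinite μ] [SFinite ν]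
    (m : Ω → X → X) (hm : Measurable (Function.uncurry m))
    (hmq : ∀ u, Measure.QuasiMeasurePreserving (m u) ν ν)
    (Φ : Ω → ℂ) (hΦ : ¬ AEStronglyMeasurable Φ μ)
    (f : X → ℂ) (hf : Measurable f) (hf0 : ∀ᵐ x ∂ν, f x ≠ 0) :
    ∀ᵐ x ∂ν, ∫ u, Φ u * f (m u x) ∂μ = 0 := by
  have hs : MeasurableSet {p : Ω × X | f (m p.1 p.2) ≠ 0} :=
    (hf.comp hm) (measurableSet_singleton (0 : ℂ)).compl
  have h1 : ∀ᵐ x ∂ν, ∀ᵐ u ∂μ, f (m u x) ≠ 0 :=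
    (Measure.ae_ae_comm (p := fun u x => f (m u x) ≠ 0) hs).1
      (ae_of_all _ fun u => (hmq u).ae hf0)
  filter_upwards [h1] with x hx
  refine integral_undef fun hi => hΦ ?_
  have hfm : Measurable fun u => f (m u x) := hf.comp (hm.comp measurable_prodMk_right)
  refine (hi.1.mul hfm.inv.stronglyMeasurable.aestronglyMeasurable).congr ?_
  filter_upwards [hx] with u hu
  simp [hu]

theorem exists_Lp_two_sub_eq_of_ae_ne_zero {X : Type*} [MeasurableSpace X] {ν : Measure X}
    [SigmaFinite ν] (f : Lp ℂ 2 ν) :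
    ∃ g h : Lp ℂ 2 ν, f = g - h ∧ (∀ᵐ x ∂ν, g x ≠ 0) ∧ ∀ᵐ x ∂ν, h x ≠ 0 := by
  classical
  obtain ⟨w, hw0, hwm, hw⟩ := exists_pos_lintegral_lt_of_sigmaFinite ν one_ne_zero
  let r : X → ℂ := fun x => (Real.sqrt (w x) : ℂ)
  have hrm : Measurable r := by
    exact Complex.measurable_ofReal.comp (measurable_coe_nnreal_real.comp hwm).sqrt
  have hr0 : ∀ x, r x ≠ 0 := fun x => by
    have : (0 : ℝ) < w x := hw0 x
    simpa [r] using (Real.sqrt_pos.2 this).ne'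
  have hr : MemLp r 2 ν := by
    refine (memLp_two_iff_integrable_sq_norm hrm.aestronglyMeasurable).2 ?_
    have : (fun x => ‖r x‖ ^ 2) = fun x => (w x : ℝ) := by
      ext x
      simp [r, Real.sq_sqrt]
    rw [this]
    refine ⟨(measurable_coe_nnreal_real.comp hwm).aestronglyMeasurable, ?_⟩
    rw [hasFiniteIntegral_iff_enorm]
    simpa using hw.trans ENNReal.one_lt_top
  have hfm : Measurable f := (Lp.stronglyMeasurable f).measurable
  have hs : MeasurableSet {x | f x = 0} := hfm (measurableSet_singleton 0)
  let h : X → ℂ := fun x => if f x = 0 then r x else f x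
  have hhm : Measurable h := Measurable.ite hs hrm hfm
  have hh : MemLp h 2 ν := by
    refine ((Lp.memLp f).norm.add hr.norm).of_le hhm.aestronglyMeasurable (ae_of_all _ fun x => ?_)
    rw [Pi.add_apply, Real.norm_of_nonneg (by positivity)]
    simp only [h]
    split_ifs
    · exact le_add_of_nonneg_left (norm_nonneg _)
    · exact le_add_of_nonneg_right (norm_nonneg _)
  have hh0 : ∀ x, h x ≠ 0 := by
    intro x
    simp only [h]
    split_ifs with hx
    · exact hr0 x
    · exact hx
  refine ⟨f + hh.toLp, hh.toLp, by simp, ?_, ?_⟩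
  · filter_upwards [Lp.coeFn_add f hh.toLp, hh.coeFn_toLp] with x h1 h2
    rw [h1, Pi.add_apply, h2]
    by_cases hx : f x = 0
    · rw [hx, zero_add]
      exact hh0 x
    · simp only [h, hx, if_false, ← two_mul]
      exact mul_ne_zero two_ne_zero hx
  · filter_upwards [hh.coeFn_toLp] with x h2
    rw [h2]
    exact hh0 x

theorem exists_ne_top_map_mulVec_eq_smul {n : ℕ} {M : Matrix (Fin n) (Fin n) ℝ} (hM : M.det ≠ 0) :
    ∃ r : ℝ≥0∞, r ≠ ∞ ∧
      (volume : Measure (Fin n → ℝ)).map (fun x => M *ᵥ x) = r • volume := by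
  have h : ⇑(Matrix.toLin' M) = fun x => M *ᵥ x := funext fun x => Matrix.toLin'_apply _ _
  exact ⟨_, ENNReal.ofReal_ne_top, h ▸ Real.map_matrix_volume_pi_eq_smul_volume_pi hM⟩

theorem measurable_uncurry_mulVec_conj_diagonal {Ω : Type*} [MeasurableSpace Ω] {n : ℕ}
    (M N : Matrix (Fin n) (Fin n) ℝ) (a : Ω → Fin n → ℝ) (ha : ∀ j, Measurable fun u => a u j) :
    Measurable (Function.uncurry fun u (x : Fin n → ℝ) =>
      (M * Matrix.diagonal (a u) * N) *ᵥ x) := by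
  have hmul : ∀ M : Matrix (Fin n) (Fin n) ℝ, Measurable fun x : Fin n → ℝ => M *ᵥ x := fun M =>
    (Continuous.matrix_mulVec continuous_const continuous_id).measurable
  have h : Measurable fun p : Ω × (Fin n → ℝ) => fun j => a p.1 j * (N *ᵥ p.2) j := by
    refine measurable_pi_lambda _ fun j => ?_
    exact ((ha j).comp measurable_fst).mul
      ((measurable_pi_apply j).comp ((hmul N).comp measurable_snd))
  convert (hmul M).comp h using 1
  ext1 p
  change (M * Matrix.diagonal (a p.1) * N) *ᵥ p.2 = M *ᵥ fun j => a p.1 j * (N *ᵥ p.2) j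
  rw [← Matrix.mulVec_mulVec, ← Matrix.mulVec_mulVec]
  congr 1
  ext j
  rw [Matrix.mulVec_diagonal]

/-- A transform diagonalizing all substitutions by matrices `C⁻¹ diag(a) C` turns a Hausdorff
operator with such matrices into multiplication by its symbol. -/
theorem ae_eq_symbol_smul_of_realizes {Ω H : Type*} [MeasurableSpace Ω] {μ : Measure Ω}
    [SigmaFinite μ] [NormedAddCommGroup H] [InnerProductSpace ℂ H] {n : ℕ}
    {C : Matrix (Fin n) (Fin n) ℝ} (hC : C * Cᵀ = 1)
    (V : Lp ℂ 2 (volume : Measure (Fin n → ℝ)) ≃ₗᵢ[ℂ] Lp H 2 (volume : Measure (Fin n → ℝ)))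
    (hV : ∀ a : Fin n → ℝ, (∀ j, 0 < a j) → ∀ f g : Lp ℂ 2 (volume : Measure (Fin n → ℝ)),
        (∀ᵐ x, g x = f ((C⁻¹ * Matrix.diagonal a * C) *ᵥ x)) →
        ∀ᵐ s, V g s =
          (∏ j, (a j : ℂ) ^ (-(1 / 2 : ℂ) - Complex.I * (s j : ℂ))) • V f s)
    (Φ : Ω → ℂ) (A : Ω → Matrix (Fin n) (Fin n) ℝ) (a : Fin n → Ω → ℝ)
    (ha : ∀ j, Measurable (a j))
    (hapos : ∀ᵐ u ∂μ, Φ u ≠ 0 → ∀ j, 0 < a j u)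
    (hdiag : ∀ᵐ u ∂μ, Φ u ≠ 0 → A u = C⁻¹ * Matrix.diagonal (fun j => a j u) * C)
    (hInt : Integrable (fun u => ‖Φ u‖ * (∏ j, a j u) ^ (-((1 : ℝ) / 2))) μ)
    (T : Lp ℂ 2 (volume : Measure (Fin n → ℝ)) →L[ℂ] Lp ℂ 2 (volume : Measure (Fin n → ℝ)))
    (hT : ∀ f, ∀ᵐ x, T f x = ∫ u, Φ u * f (A u *ᵥ x) ∂μ)
    (φ : (Fin n → ℝ) → ℂ)
    (hφ : ∀ s, φ s = ∫ u, Φ u * ∏ j, (a j u : ℂ) ^ (-(1 / 2 : ℂ) - Complex.I * (s j : ℂ)) ∂μ)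
    (f : Lp ℂ 2 (volume : Measure (Fin n → ℝ))) :
    ∀ᵐ s, V (T f) s = φ s • V f s := by
  have hCu : IsUnit C.det := (Matrix.isUnit_iff_isUnit_det C).1 (IsUnit.of_mul_eq_one _ hC)
  let a' : Ω → Fin n → ℝ := fun u j => if 0 < a j u then a j u else 1
  have ha'm : ∀ j, Measurable fun u => a' u j := fun j =>
    Measurable.ite (measurableSet_lt measurable_const (ha j)) (ha j) measurable_const
  have ha'0 : ∀ u j, 0 < a' u j := by
    intro u j
    simp only [a']
    split_ifs with h
    exacts [h, one_pos]
  have ha' : ∀ᵐ u ∂μ, Φ u ≠ 0 → ∀ j, a' u j = a j u := by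
    filter_upwards [hapos] with u hu h j
    exact if_pos (hu h j)
  let m : Ω → (Fin n → ℝ) → (Fin n → ℝ) := fun u x => (C⁻¹ * Matrix.diagonal (a' u) * C) *ᵥ x
  have hm : Measurable (Function.uncurry m) :=
    measurable_uncurry_mulVec_conj_diagonal _ C a' ha'm
  have hmu : ∀ u, Measurable (m u) := fun _ => hm.of_uncurry_left
  have hmap : ∀ u, ∃ r : ℝ≥0∞, r ≠ ∞ ∧ (volume : Measure (Fin n → ℝ)).map (m u) = r • volume := by
    intro u
    refine exists_ne_top_map_mulVec_eq_smul ?_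
    rw [Matrix.det_mul, Matrix.det_mul, Matrix.det_diagonal]
    have h1 : C.det ≠ 0 := hCu.ne_zero
    have h2 : C⁻¹.det ≠ 0 := by
      rw [Matrix.det_nonsing_inv, Ring.inverse_eq_inv']
      exact inv_ne_zero h1
    exact mul_ne_zero (mul_ne_zero h2 (Finset.prod_pos fun j _ => ha'0 u j).ne') h1
  have hmq : ∀ u, Measure.QuasiMeasurePreserving (m u) volume volume := by
    intro u
    obtain ⟨r, -, hr⟩ := hmap u
    exact ⟨hmu u, hr ▸ Measure.smul_absolutelyContinuous⟩
  have hmem : ∀ u (f : Lp ℂ 2 (volume : Measure (Fin n → ℝ))), MemLp (fun x => f (m u x)) 2 := by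
    intro u f
    obtain ⟨r, hr, h⟩ := hmap u
    refine MemLp.comp_of_map (f := m u) (g := f) ?_ (hmu u).aemeasurable
    rw [h]
    exact (Lp.memLp f).smul_measure hr
  let e : Ω → (Fin n → ℝ) → ℂ := fun u s =>
    ∏ j, (a' u j : ℂ) ^ (-(1 / 2 : ℂ) - Complex.I * (s j : ℂ))
  have he : Measurable (Function.uncurry e) := by
    refine Finset.measurable_prod _ fun j _ => Measurable.pow
      (Complex.measurable_ofReal.comp ((ha'm j).comp measurable_fst)) ?_
    exact measurable_const.sub (measurable_const.mul
      (Complex.measurable_ofReal.comp ((measurable_pi_apply j).comp measurable_snd)))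
  have hce : ∀ u s, ‖e u s‖ = (∏ j, a' u j) ^ (-((1 : ℝ) / 2)) := by
    intro u s
    rw [← Real.finsetProd_rpow _ _ fun j _ => (ha'0 u j).le, norm_prod]
    refine Finset.prod_congr rfl fun j _ => ?_
    rw [Complex.norm_cpow_eq_rpow_re_of_pos (ha'0 u j)]
    congr 1
    simp
  have he0 : ∀ u s, e u s ≠ 0 := by
    intro u s h
    have h1 := hce u s
    rw [h, norm_zero] at h1
    exact (Real.rpow_pos_of_pos (Finset.prod_pos fun j _ => ha'0 u j) _).ne h1
  have hφ' : ∀ s, φ s = ∫ u, Φ u * e u s ∂μ := by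
    intro s
    rw [hφ]
    refine integral_congr_ae ?_
    filter_upwards [ha'] with u hu
    by_cases h : Φ u = 0
    · simp [h]
    · simp only [e, hu h]
  have hT' : ∀ f, ∀ᵐ x, T f x = ∫ u, Φ u * f (m u x) ∂μ := by
    intro f
    filter_upwards [hT f] with x hx
    rw [hx]
    refine integral_congr_ae ?_
    filter_upwards [ha', hdiag] with u hu hd
    by_cases h : Φ u = 0
    · simp [h]
    · rw [hd h]
      simp only [m, funext (hu h)]
  by_cases hΦ : AEStronglyMeasurable Φ μ
  · have hintm : Integrable (fun u => ‖hΦ.mk Φ u‖ * (∏ j, a' u j) ^ (-((1 : ℝ) / 2))) μ := by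
      refine hInt.congr ?_
      filter_upwards [ha', hΦ.ae_eq_mk] with u hu hk
      rw [← hk]
      by_cases h : Φ u = 0
      · simp [h]
      · simp only [hu h]
    have hTm : ∀ᵐ x, T f x = ∫ u, hΦ.mk Φ u * f (m u x) ∂μ := by
      filter_upwards [hT' f] with x hx
      rw [hx]
      refine integral_congr_ae ?_
      filter_upwards [hΦ.ae_eq_mk] with u hu
      rw [hu]
    filter_upwards [intertwines_integral_of_intertwines V m hm hmem e he _ hce
      (fun u => hV (a' u) (ha'0 u)) _ hΦ.stronglyMeasurable_mk hintm f (T f) hTm] with s hs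
    rw [hs, hφ']
    congr 1
    refine integral_congr_ae ?_
    filter_upwards [hΦ.ae_eq_mk] with u hu
    rw [hu]
  · have hφ0 : ∀ s, φ s = 0 := by
      intro s
      rw [hφ']
      refine integral_undef fun hi => hΦ ?_
      have hes : Measurable fun u => e u s := he.comp measurable_prodMk_right
      refine (hi.aestronglyMeasurable.mul hes.inv.aestronglyMeasurable).congr
        (ae_of_all _ fun u => ?_)
      exact mul_inv_cancel_right₀ (he0 u s) _
    have hT0 : ∀ g : Lp ℂ 2 (volume : Measure (Fin n → ℝ)), (∀ᵐ x, g x ≠ 0) → T g = 0 := by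
      intro g hg
      refine Lp.ext ?_
      filter_upwards [hT' g, ae_integral_mul_eq_zero_of_not_aestronglyMeasurable m hm hmq Φ hΦ g
        (Lp.stronglyMeasurable g).measurable hg, Lp.coeFn_zero ℂ 2 volume] with x h1 h2 h3
      rw [h1, h2, h3, Pi.zero_apply]
    obtain ⟨g, h, hf, hg, hh⟩ := exists_Lp_two_sub_eq_of_ae_ne_zero f
    have hTf : T f = 0 := by
      rw [hf, map_sub, hT0 g hg, hT0 h hh, sub_zero]
    rw [hTf, map_zero]
    filter_upwards [Lp.coeFn_zero H 2 (volume : Measure (Fin n → ℝ))] with s hs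
    rw [hs, hφ0, zero_smul, Pi.zero_apply]

end

/-- The product of two Hausdorff operators on `L²(ℝⁿ)` whose matrix families are simultaneously
diagonalized by the same orthogonal matrix `C` (hence form one pairwise commuting family of
symmetric positive definite matrices) is unitarily equivalent to multiplication by the product
`φψ` of their symbols on `L²(ℝⁿ; ℂ^{2^n})`. -/
theorem hausdorff_product_structure {Ω : Type*} [MeasurableSpace Ω] (μ : Measure Ω)
    [SigmaFinite μ] (n : ℕ)
    (Φ Ψ : Ω → ℂ) (A B : Ω → Matrix (Fin n) (Fin n) ℝ)
    (C : Matrix (Fin n) (Fin n) ℝ) (hC : C * Cᵀ = 1)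
    (a b : Fin n → Ω → ℝ) (ha : ∀ j, Measurable (a j)) (hb : ∀ j, Measurable (b j))
    (hapos : ∀ᵐ u ∂μ, Φ u ≠ 0 → ∀ j, 0 < a j u)
    (hbpos : ∀ᵐ v ∂μ, Ψ v ≠ 0 → ∀ j, 0 < b j v)
    (hdiagA : ∀ᵐ u ∂μ, Φ u ≠ 0 → A u = C⁻¹ * Matrix.diagonal (fun j => a j u) * C)
    (hdiagB : ∀ᵐ v ∂μ, Ψ v ≠ 0 → B v = C⁻¹ * Matrix.diagonal (fun j => b j v) * C)
    (hintA : Integrable (fun u => ‖Φ u‖ * (∏ j, a j u) ^ (-((1 : ℝ) / 2))) μ)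
    (hintB : Integrable (fun v => ‖Ψ v‖ * (∏ j, b j v) ^ (-((1 : ℝ) / 2))) μ)
    (TΦ TΨ : Lp ℂ 2 (volume : Measure (Fin n → ℝ)) →L[ℂ] Lp ℂ 2 (volume : Measure (Fin n → ℝ)))
    (hTΦ : ∀ f : Lp ℂ 2 (volume : Measure (Fin n → ℝ)),
      ∀ᵐ x : Fin n → ℝ ∂volume, TΦ f x = ∫ u, Φ u * f ((A u).mulVec x) ∂μ)
    (hTΨ : ∀ f : Lp ℂ 2 (volume : Measure (Fin n → ℝ)),
      ∀ᵐ x : Fin n → ℝ ∂volume, TΨ f x = ∫ v, Ψ v * f ((B v).mulVec x) ∂μ)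
    (φ ψ : (Fin n → ℝ) → ℂ)
    (hφ : ∀ s : Fin n → ℝ,
      φ s = ∫ u, Φ u * ∏ j, (a j u : ℂ) ^ (-(1 / 2 : ℂ) - Complex.I * (s j : ℂ)) ∂μ)
    (hψ : ∀ s : Fin n → ℝ,
      ψ s = ∫ v, Ψ v * ∏ j, (b j v : ℂ) ^ (-(1 / 2 : ℂ) - Complex.I * (s j : ℂ)) ∂μ) :
    ∃ V : Lp ℂ 2 (volume : Measure (Fin n → ℝ)) ≃ₗᵢ[ℂ]
        Lp (EuclideanSpace ℂ (Fin (2 ^ n))) 2 (volume : Measure (Fin n → ℝ)),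
      ∀ f : Lp ℂ 2 (volume : Measure (Fin n → ℝ)),
        ∀ᵐ s : Fin n → ℝ ∂volume, V ((TΦ ∘L TΨ) f) s = (φ s * ψ s) • V f s := by
  obtain ⟨V, hV⟩ := exists_mellin_linearIsometryEquiv hC
  refine ⟨V, fun f => ?_⟩
  filter_upwards [ae_eq_symbol_smul_of_realizes hC V hV Φ A a ha hapos hdiagA hintA TΦ hTΦ φ hφ
      (TΨ f), ae_eq_symbol_smul_of_realizes hC V hV Ψ B b hb hbpos hdiagB hintB TΨ hTΨ ψ hψ f]
    with s h1 h2
  rw [ContinuousLinearMap.comp_apply, h1, h2, smul_smul]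
end

section
/- Under the hypotheses of Theorem 1 (A(u) = C⁻¹ diag(a_1(u),…,a_n(u)) C with C orthogonal and a_j(u) > 0 μ-measurable, u ↦ |Φ(u)|(a_1(u)⋯a_n(u))^{-1/2} μ-integrable, T a continuous linear operator on L²(ℝⁿ;ℂ) realizing H_{Φ,A}), the spectrum of T equals the closure in ℂ of the range of the symbol φ: σ(T) = cl{φ(s) : s ∈ ℝⁿ}. -/
open MeasureTheory Complex Filter Matrix
open scoped ENNReal ComplexConjugate

section Plancherel

open FourierTransform SchwartzMap

variable {E : Type*} [NormedAddCommGroup E] [InnerProductSpace ℝ E] [FiniteDimensional ℝ E]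
  [MeasurableSpace E] [BorelSpace E]

/-- The `L²` Fourier transform agrees with the integral one on `L¹ ∩ L²`. -/
theorem lp_fourier_toLp_ae_eq {f : E → ℂ} (hf : Integrable f) (hf2 : MemLp f 2) :
    (𝓕 (hf2.toLp f) : Lp ℂ 2 (volume : Measure E)) =ᵐ[volume] 𝓕 f := by
  refine ae_eq_of_integral_contDiff_smul_eq ?_ ?_ ?_
  · exact (Lp.memLp _).locallyIntegrable (by norm_num)
  · exact (VectorFourier.fourierIntegral_continuous Real.continuous_fourierChar
      continuous_inner hf).locallyIntegrable
  · intro g hg hgc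
    have h1 : ContDiff ℝ ((⊤ : ℕ∞) : WithTop ℕ∞) (fun x => (g x : ℂ)) :=
      Complex.ofRealCLM.contDiff.comp hg
    have h2 : HasCompactSupport (fun x => (g x : ℂ)) := hgc.comp_left (g := Complex.ofReal) (by simp)
    set ψ : 𝓢(E, ℂ) := h2.toSchwartzMap h1 with hψ
    have hψx : ∀ x, ψ x = (g x : ℂ) := fun x => by simp [hψ]
    have := congrArg (fun T : 𝓢'(E, ℂ) => T ψ) (Lp.fourier_toTemperedDistribution_eq (hf2.toLp f))
    simp only [TemperedDistribution.fourier_apply, Lp.toTemperedDistribution_apply] at this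
    have e1 : ∫ x, g x • (𝓕 (hf2.toLp f) : Lp ℂ 2 (volume : Measure E)) x
      = ∫ x, ψ x • (𝓕 (hf2.toLp f) : Lp ℂ 2 (volume : Measure E)) x := by
      simp [hψx]
    rw [e1, ← this]
    have e2 : ∫ x, (𝓕 ψ) x • (hf2.toLp f) x = ∫ x, (𝓕 ψ) x • f x := by
      refine integral_congr_ae ?_
      filter_upwards [hf2.coeFn_toLp] with x hx
      rw [hx]
    rw [e2]
    have e3 := VectorFourier.integral_fourierIntegral_smul_eq_flip (L := innerₗ E)
      (f := ψ) (g := f) (μ := volume) (ν := volume) Real.continuous_fourierChar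
      continuous_inner ψ.integrable hf
    rw [flip_innerₗ] at e3
    have e4 : ∫ x, g x • 𝓕 f x = ∫ x, ψ x • 𝓕 f x := by simp [hψx]
    rw [e4]
    exact e3

/-- Plancherel's identity for the integral Fourier transform on `L¹ ∩ L²`. -/
theorem lintegral_enorm_fourier_sq {f : E → ℂ} (hf : Integrable f) (hf2 : MemLp f 2) :
    ∫⁻ s, ‖𝓕 f s‖ₑ ^ 2 = ∫⁻ t, ‖f t‖ₑ ^ 2 := by
  have key : eLpNorm (𝓕 f) 2 volume = eLpNorm f 2 volume := by
    rw [← eLpNorm_congr_ae (lp_fourier_toLp_ae_eq hf hf2), ← eLpNorm_congr_ae hf2.coeFn_toLp,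
      ← Lp.enorm_def, ← Lp.enorm_def, ← ofReal_norm, ← ofReal_norm, Lp.norm_fourier_eq]
  have h (g : E → ℂ) : eLpNorm g 2 volume ^ 2 = ∫⁻ t, ‖g t‖ₑ ^ 2 := by
    have := eLpNorm_nnreal_pow_eq_lintegral (μ := (volume : Measure E)) (f := g) (p := 2) (by norm_num)
    simpa using this
  rw [← h, ← h, key]

end Plancherel

section SquareIntegrals

variable {Ω X : Type*} [MeasurableSpace Ω] [MeasurableSpace X]

theorem eLpNorm_two_sq {m : Measure X} (f : X → ℂ) :
    eLpNorm f 2 m ^ 2 = ∫⁻ x, ‖f x‖ₑ ^ 2 ∂m := by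
  simpa using eLpNorm_nnreal_pow_eq_lintegral (μ := m) (f := f) (p := 2) (by norm_num)

theorem lintegral_mul_sq_le {μ : Measure Ω} {c q : Ω → ℝ≥0∞} (hc : Measurable c)
    (hq : Measurable q) :
    (∫⁻ u, c u * q u ∂μ) ^ 2 ≤ (∫⁻ u, c u ∂μ) * ∫⁻ u, c u * q u ^ 2 ∂μ := by
  have hs : ∀ y : ℝ≥0∞, y ^ (1 / 2 : ℝ) * y ^ (1 / 2 : ℝ) = y := fun y => by
    rw [← ENNReal.rpow_add_of_nonneg _ _ (by norm_num) (by norm_num)]; norm_num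
  have hs2 : ∀ y : ℝ≥0∞, (y ^ (1 / 2 : ℝ)) ^ 2 = y := fun y => by rw [sq, hs]
  have h := ENNReal.lintegral_mul_le_Lp_mul_Lq μ Real.HolderConjugate.two_two
    (f := fun u => c u ^ (1 / 2 : ℝ)) (g := fun u => c u ^ (1 / 2 : ℝ) * q u)
    (by fun_prop) (by fun_prop)
  simp only [Pi.mul_apply, ← mul_assoc, hs, ENNReal.rpow_two, mul_pow, hs2] at h
  calc _ ≤ _ := pow_le_pow_left' h 2
    _ = _ := by rw [mul_pow, hs2, hs2]

/-- Cauchy–Schwarz form of Minkowski's integral inequality in `L²`. -/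
theorem lintegral_lintegral_mul_sq_le {μ : Measure Ω} {m : Measure X} [SFinite μ] [SFinite m]
    {c : Ω → ℝ≥0∞} {q : Ω → X → ℝ≥0∞} (hc : Measurable c)
    (hq : Measurable (Function.uncurry q)) :
    ∫⁻ x, (∫⁻ u, c u * q u x ∂μ) ^ 2 ∂m ≤
      (∫⁻ u, c u ∂μ) * ∫⁻ u, c u * ∫⁻ x, q u x ^ 2 ∂m ∂μ := by
  have hq' : Measurable fun p : Ω × X => q p.1 p.2 := hq
  calc _ ≤ ∫⁻ x, (∫⁻ u, c u ∂μ) * ∫⁻ u, c u * q u x ^ 2 ∂μ ∂m :=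
        lintegral_mono fun x => lintegral_mul_sq_le hc (hq'.of_uncurry_right)
    _ = (∫⁻ u, c u ∂μ) * ∫⁻ x, ∫⁻ u, c u * q u x ^ 2 ∂μ ∂m := by
        rw [lintegral_const_mul]
        have : Measurable fun p : X × Ω => c p.2 * q p.2 p.1 ^ 2 := by fun_prop
        exact this.lintegral_prod_right'
    _ = (∫⁻ u, c u ∂μ) * ∫⁻ u, ∫⁻ x, c u * q u x ^ 2 ∂m ∂μ := by
        rw [lintegral_lintegral_swap]
        exact Measurable.aemeasurable (by fun_prop)
    _ = _ := by
        congr 1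
        refine lintegral_congr fun u => ?_
        rw [lintegral_const_mul]
        fun_prop

theorem lintegral_enorm_integral_sq_le {μ : Measure Ω} {m : Measure X} [SFinite μ] [SFinite m]
    {c : Ω → ℂ} {q : Ω → X → ℂ} (hc : Measurable c) (hq : Measurable (Function.uncurry q)) :
    ∫⁻ x, ‖∫ u, c u * q u x ∂μ‖ₑ ^ 2 ∂m ≤
      (∫⁻ u, ‖c u‖ₑ ∂μ) * ∫⁻ u, ‖c u‖ₑ * ∫⁻ x, ‖q u x‖ₑ ^ 2 ∂m ∂μ := by
  refine le_trans (lintegral_mono fun x => ?_)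
    (lintegral_lintegral_mul_sq_le (c := fun u => ‖c u‖ₑ) (q := fun u x => ‖q u x‖ₑ)
      hc.enorm hq.enorm)
  gcongr
  refine (enorm_integral_le_lintegral_enorm _).trans (le_of_eq ?_)
  simp only [enorm_mul]

/-- Squares integrated over a fibre are a.e. integrable against an integrable density. -/
theorem ae_integrable_mul {μ : Measure Ω} {m : Measure X} [SFinite μ] [SFinite m]
    {c : Ω → ℂ} {q : Ω → X → ℂ} (hc : Measurable c) (hci : Integrable c μ)
    (hq : Measurable (Function.uncurry q)) {K : ℝ≥0∞} (hK : K ≠ ∞)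
    (hqK : ∀ u, ∫⁻ x, ‖q u x‖ₑ ^ 2 ∂m ≤ K) :
    ∀ᵐ x ∂m, Integrable (fun u => c u * q u x) μ := by
  have hq' : Measurable fun p : Ω × X => q p.1 p.2 := hq
  have hfin : ∫⁻ u, ‖c u‖ₑ ∂μ ≠ ∞ := hci.2.ne
  have h1 : ∫⁻ x, (∫⁻ u, ‖c u‖ₑ * ‖q u x‖ₑ ∂μ) ^ 2 ∂m ≠ ∞ := by
    refine ne_top_of_le_ne_top ?_ (lintegral_lintegral_mul_sq_le (c := fun u => ‖c u‖ₑ)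
      (q := fun u x => ‖q u x‖ₑ) hc.enorm hq.enorm)
    refine ENNReal.mul_ne_top hfin (ne_top_of_le_ne_top (b := (∫⁻ u, ‖c u‖ₑ ∂μ) * K) ?_ ?_)
    · exact ENNReal.mul_ne_top hfin hK
    · rw [← lintegral_mul_const _ hc.enorm]
      exact lintegral_mono fun u => mul_le_mul_right (hqK u) _
  have hm : Measurable fun p : X × Ω => ‖c p.2‖ₑ * ‖q p.2 p.1‖ₑ := by fun_prop
  filter_upwards [ae_lt_top (hm.lintegral_prod_right'.pow_const 2) h1] with x hx
  refine ⟨Measurable.aestronglyMeasurable (by fun_prop), ?_⟩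
  simp only [HasFiniteIntegral, enorm_mul]
  exact (ENNReal.pow_lt_top_iff.1 hx).resolve_right (by norm_num)

/-- Two functions of equal `L²` norm whose difference is pointwise at most `κ` times one of them. -/
theorem lintegral_enorm_sub_sq_le {m : Measure X} {a b : X → ℂ} (ha : Measurable a) {κ : ℝ}
    (hab : ∫⁻ x, ‖a x‖ₑ ^ 2 ∂m = ∫⁻ x, ‖b x‖ₑ ^ 2 ∂m) (hκ : ∀ᵐ x ∂m, ‖a x - b x‖ ≤ κ * ‖b x‖) :
    ∫⁻ x, ‖a x - b x‖ₑ ^ 2 ∂m ≤ ENNReal.ofReal (min 4 (κ ^ 2)) * ∫⁻ x, ‖b x‖ₑ ^ 2 ∂m := by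
  have hsq : ∀ z : ℂ, ‖z‖ₑ ^ 2 = ENNReal.ofReal (‖z‖ ^ 2) := fun z => by
    rw [← ofReal_norm, ENNReal.ofReal_pow (norm_nonneg _)]
  rcases min_choice 4 (κ ^ 2) with h | h <;> rw [h]
  · calc _ ≤ ∫⁻ x, (2 * ‖a x‖ₑ ^ 2 + 2 * ‖b x‖ₑ ^ 2) ∂m := by
          refine lintegral_mono fun x => ?_
          simp only [hsq]
          rw [← ENNReal.ofReal_ofNat 2, ← ENNReal.ofReal_mul (by norm_num),
            ← ENNReal.ofReal_mul (by norm_num), ← ENNReal.ofReal_add (by positivity) (by positivity)]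
          refine ENNReal.ofReal_le_ofReal ?_
          have := norm_sub_le (a x) (b x)
          nlinarith [norm_nonneg (a x - b x), sq_nonneg (‖a x‖ - ‖b x‖)]
      _ = _ := by
          rw [lintegral_add_left (by fun_prop), lintegral_const_mul' _ _ (by norm_num),
            lintegral_const_mul' _ _ (by norm_num), hab, ← add_mul]
          norm_num
  · rw [← lintegral_const_mul' _ _ ENNReal.ofReal_ne_top]
    refine lintegral_mono_ae ?_
    filter_upwards [hκ] with x hx
    rw [hsq, hsq, ← ENNReal.ofReal_mul (sq_nonneg _), ← mul_pow]
    exact ENNReal.ofReal_le_ofReal (pow_le_pow_left₀ (norm_nonneg _) hx 2)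

theorem tendsto_lintegral_min_exp_sub_one {μ : Measure Ω} {c : Ω → ℂ} (hc : Measurable c)
    (hci : Integrable c μ) {N : Ω → ℝ} (hN : Measurable N) :
    Tendsto (fun k : ℕ => ∫⁻ u, ‖c u‖ₑ *
        ENNReal.ofReal (min 4 ((Real.exp ((1 / ((k : ℝ) + 1)) * N u) - 1) ^ 2)) ∂μ)
      atTop (nhds 0) := by
  have h0 : ∫⁻ _ : Ω, (0 : ℝ≥0∞) ∂μ = 0 := lintegral_zero
  rw [← h0]
  refine tendsto_lintegral_of_dominated_convergence (fun u => ‖c u‖ₑ * 4) (fun k => by fun_prop)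
    (fun k => Eventually.of_forall fun u => ?_) ?_ (Eventually.of_forall fun u => ?_)
  · refine mul_le_mul_right ?_ _
    rw [← ENNReal.ofReal_ofNat 4]
    exact ENNReal.ofReal_le_ofReal (min_le_left _ _)
  · rw [lintegral_mul_const _ hc.enorm]
    exact ENNReal.mul_ne_top hci.2.ne (by norm_num)
  · have h1 : Tendsto (fun k : ℕ => min 4 ((Real.exp ((1 / ((k : ℝ) + 1)) * N u) - 1) ^ 2))
        atTop (nhds 0) := by
      have h2 := ((Real.continuous_exp.tendsto _).comp
        (tendsto_one_div_add_atTop_nhds_zero_nat.mul_const (N u))).sub_const 1 |>.pow 2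
      have h3 := (tendsto_const_nhds (x := (4 : ℝ))).min h2
      simpa using h3
    have h4 := ENNReal.Tendsto.const_mul (a := ‖c u‖ₑ) (ENNReal.tendsto_ofReal h1)
      (Or.inr enorm_ne_top)
    simpa using h4

end SquareIntegrals

/-- A measurable action of an additive group on a measure space together with a multiplicative
weight that makes the weighted composition operators isometric on `L²`. -/
structure WeightedAction (E : Type*) {X : Type*} [AddCommGroup E] [MeasurableSpace E]
    [MeasurableSpace X] (m : Measure X) where
  act : E → X → X
  weight : E → ℝ
  measurable_act : Measurable fun p : E × X => act p.1 p.2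
  measurable_weight : Measurable weight
  act_zero : ∀ x, act 0 x = x
  act_add : ∀ s t x, act (s + t) x = act s (act t x)
  weight_pos : ∀ t, 0 < weight t
  weight_add : ∀ s t, weight (s + t) = weight s * weight t
  lintegral_act : ∀ t (F : X → ℝ≥0∞), Measurable F →
    ∫⁻ x, ENNReal.ofReal (weight t) ^ 2 * F (act t x) ∂m = ∫⁻ x, F x ∂m

namespace WeightedAction

section Basic

variable {E X Ω : Type*} [AddCommGroup E] [MeasurableSpace E] [MeasurableSpace X]
  [MeasurableSpace Ω] {m : Measure X} (S : WeightedAction E m)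

/-- The weighted composition operator. -/
def comp (t : E) (f : X → ℂ) (x : X) : ℂ := S.weight t * f (S.act t x)

/-- The average of the weighted composition operators along `τ` with density `c`. -/
noncomputable def avg (μ : Measure Ω) (c : Ω → ℂ) (τ : Ω → E) (f : X → ℂ) (x : X) : ℂ :=
  ∫ u, c u * S.comp (τ u) f x ∂μ

theorem measurable_comp {f : X → ℂ} (hf : Measurable f) :
    Measurable fun p : E × X => S.comp p.1 f p.2 := by
  unfold comp
  exact (Complex.measurable_ofReal.comp (S.measurable_weight.comp measurable_fst)).mul
    (hf.comp S.measurable_act)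

theorem measurable_comp_uncurry {f : X → ℂ} (hf : Measurable f) {τ : Ω → E} (hτ : Measurable τ) :
    Measurable fun p : Ω × X => S.comp (τ p.1) f p.2 :=
  (S.measurable_comp hf).comp ((hτ.comp measurable_fst).prodMk measurable_snd)

theorem measurable_comp_right {f : X → ℂ} (hf : Measurable f) (t : E) :
    Measurable (S.comp t f) :=
  (S.measurable_comp hf).comp measurable_prodMk_left

theorem measurable_act_right (t : E) : Measurable (S.act t) :=
  S.measurable_act.comp measurable_prodMk_left

theorem weight_zero : S.weight 0 = 1 := by
  have h := S.weight_add 0 0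
  rw [add_zero] at h
  exact (mul_eq_left₀ (S.weight_pos 0).ne').1 h.symm

theorem comp_comp (s t : E) (f : X → ℂ) : S.comp t (S.comp s f) = S.comp (t + s) f := by
  ext x
  simp only [comp]
  rw [S.weight_add, add_comm t s, S.act_add]
  push_cast
  ring

theorem lintegral_comp_sq {f : X → ℂ} (hf : Measurable f) (t : E) :
    ∫⁻ x, ‖S.comp t f x‖ₑ ^ 2 ∂m = ∫⁻ x, ‖f x‖ₑ ^ 2 ∂m := by
  rw [← S.lintegral_act t (fun x => ‖f x‖ₑ ^ 2) (by fun_prop)]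
  refine lintegral_congr fun x => ?_
  rw [comp, enorm_mul, mul_pow, ← ofReal_norm, Complex.norm_real, Real.norm_eq_abs,
    abs_of_pos (S.weight_pos t)]

theorem quasiMeasurePreserving_act (t : E) : Measure.QuasiMeasurePreserving (S.act t) m m := by
  refine ⟨S.measurable_act_right t, Measure.AbsolutelyContinuous.mk fun s hs h0 => ?_⟩
  rw [Measure.map_apply (S.measurable_act_right t) hs]
  have h := S.lintegral_act t (s.indicator 1) (measurable_one.indicator hs)
  rw [lintegral_indicator_one hs, h0,
    lintegral_const_mul' _ _ (ENNReal.pow_ne_top ENNReal.ofReal_ne_top), mul_eq_zero] at h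
  have h1 : ∫⁻ x, s.indicator 1 (S.act t x) ∂m = 0 := by
    refine h.resolve_left (pow_ne_zero _ ?_)
    simpa using S.weight_pos t
  rw [← h1, ← lintegral_indicator_one (S.measurable_act_right t hs)]
  rfl

theorem comp_congr_ae {f g : X → ℂ} (h : f =ᵐ[m] g) (t : E) : S.comp t f =ᵐ[m] S.comp t g := by
  filter_upwards [(S.quasiMeasurePreserving_act t).ae_eq h] with x hx
  simp only [comp]
  congr 1

theorem map_act (t : E) :
    Measure.map (S.act t) (ENNReal.ofReal (S.weight t ^ 2) • m) = m := by
  ext s hs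
  rw [Measure.map_apply (S.measurable_act_right t) hs, Measure.smul_apply,
    ← lintegral_indicator_one (S.measurable_act_right t hs), ← lintegral_indicator_one hs,
    ← S.lintegral_act t (s.indicator 1) (measurable_one.indicator hs),
    lintegral_const_mul' _ _ (ENNReal.pow_ne_top ENNReal.ofReal_ne_top),
    ENNReal.ofReal_pow (S.weight_pos t).le]
  rfl

theorem integral_act {F : X → ℂ} (hF : Measurable F) (t : E) :
    ∫ x, (S.weight t : ℂ) ^ 2 * F (S.act t x) ∂m = ∫ x, F x ∂m := by
  conv_rhs => rw [← S.map_act t]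
  rw [integral_map (S.measurable_act_right t).aemeasurable hF.aestronglyMeasurable,
    integral_smul_measure, integral_const_mul, ENNReal.toReal_ofReal (by positivity),
    Complex.real_smul]
  push_cast
  rfl

/-- The adjoint of `S.comp t` is `S.comp (-t)`. -/
theorem integral_conj_mul_comp {f g : X → ℂ} (hf : Measurable f) (hg : Measurable g) (t : E) :
    ∫ x, conj (g x) * S.comp t f x ∂m = ∫ x, conj (S.comp (-t) g x) * f x ∂m := by
  have hg' := S.measurable_comp_right hg (-t)
  rw [← S.integral_act (F := fun x => conj (S.comp (-t) g x) * f x) (by fun_prop) t]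
  refine integral_congr_ae (Eventually.of_forall fun x => ?_)
  have h1 : S.weight (-t) * S.weight t = 1 := by
    rw [← S.weight_add, neg_add_cancel, S.weight_zero]
  have h2 : (S.weight (-t) : ℂ) * S.weight t = 1 := by exact_mod_cast h1
  simp only [comp, ← S.act_add, neg_add_cancel, S.act_zero, map_mul, Complex.conj_ofReal]
  linear_combination (-conj (g x) * S.weight t * f (S.act t x)) * h2

end Basic

section Average

variable {E X Ω : Type*} [AddCommGroup E] [MeasurableSpace E] [MeasurableSpace X]
  [MeasurableSpace Ω] {m : Measure X} (S : WeightedAction E m)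
  {μ : Measure Ω} [SFinite μ] {c : Ω → ℂ} {τ : Ω → E}

theorem measurable_avg (hc : Measurable c) (hτ : Measurable τ) {f : X → ℂ} (hf : Measurable f) :
    Measurable (S.avg μ c τ f) := by
  have h := S.measurable_comp_uncurry hf hτ
  have h2 : Measurable fun p : X × Ω => c p.2 * S.comp (τ p.2) f p.1 :=
    (hc.comp measurable_snd).mul (h.comp measurable_swap)
  exact (h2.stronglyMeasurable.integral_prod_right').measurable

omit [SFinite μ] in
theorem comp_avg (f : X → ℂ) (t : E) (x : X) :
    S.comp t (S.avg μ c τ f) x = ∫ u, c u * S.comp (t + τ u) f x ∂μ := by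
  simp only [← S.comp_comp]
  rw [comp, avg, ← integral_const_mul]
  refine integral_congr_ae (Eventually.of_forall fun u => ?_)
  simp only [comp]
  ring

theorem lintegral_avg_sq_le [SFinite m] (hc : Measurable c) (hτ : Measurable τ) {f : X → ℂ}
    (hf : Measurable f) :
    ∫⁻ x, ‖S.avg μ c τ f x‖ₑ ^ 2 ∂m ≤ (∫⁻ u, ‖c u‖ₑ ∂μ) ^ 2 * ∫⁻ x, ‖f x‖ₑ ^ 2 ∂m := by
  refine (lintegral_enorm_integral_sq_le hc (S.measurable_comp_uncurry hf hτ)).trans ?_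
  simp only [S.lintegral_comp_sq hf]
  rw [lintegral_mul_const _ hc.enorm, sq, mul_assoc]

theorem memLp_avg [SFinite m] (hc : Measurable c) (hci : Integrable c μ) (hτ : Measurable τ)
    {f : X → ℂ} (hf : Measurable f) (hf2 : MemLp f 2 m) : MemLp (S.avg μ c τ f) 2 m := by
  refine ⟨(S.measurable_avg hc hτ hf).aestronglyMeasurable, ?_⟩
  refine (ENNReal.pow_lt_top_iff (n := 2)).1 ?_ |>.resolve_right (by norm_num)
  rw [eLpNorm_two_sq]
  refine (S.lintegral_avg_sq_le hc hτ hf).trans_lt (ENNReal.mul_lt_top ?_ ?_)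
  · exact ENNReal.pow_lt_top hci.2
  · rw [← eLpNorm_two_sq]
    exact ENNReal.pow_lt_top hf2.2

theorem integral_conj_mul_avg [SFinite m] [MeasurableNeg E] (hc : Measurable c)
    (hci : Integrable c μ) (hτ : Measurable τ) {f g : X → ℂ} (hf : Measurable f)
    (hf2 : MemLp f 2 m) (hg : Measurable g) (hg2 : MemLp g 2 m) :
    ∫ x, conj (g x) * S.avg μ c τ f x ∂m =
      ∫ x, conj (S.avg μ (fun u => conj (c u)) (fun u => -τ u) g x) * f x ∂m := by
  have key {f g : X → ℂ} (hf : Measurable f) (hf2 : MemLp f 2 m) (hg : Measurable g)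
      (hg2 : MemLp g 2 m) {σ : Ω → E} (hσ : Measurable σ) :
      Integrable (fun p : X × Ω => conj (g p.1) * (c p.2 * S.comp (σ p.2) f p.1)) (m.prod μ) := by
    have hm := (S.measurable_comp_uncurry hf hσ).comp (measurable_swap (α := X) (β := Ω))
    have hm' : Measurable fun p : X × Ω => S.comp (σ p.2) f p.1 := hm
    have hmeas : Measurable fun p : X × Ω => conj (g p.1) * (c p.2 * S.comp (σ p.2) f p.1) :=
      (Complex.continuous_conj.measurable.comp (hg.comp measurable_fst)).mul
        ((hc.comp measurable_snd).mul hm')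
    refine ⟨hmeas.aestronglyMeasurable, ?_⟩
    rw [HasFiniteIntegral, lintegral_prod_symm' _ hmeas.enorm]
    refine lt_of_le_of_lt (b := ∫⁻ u, ‖c u‖ₑ *
      (∫⁻ x, ‖g x‖ₑ ^ 2 ∂m + ∫⁻ x, ‖f x‖ₑ ^ 2 ∂m) ∂μ) ?_ ?_
    · refine lintegral_mono fun u => ?_
      rw [← S.lintegral_comp_sq hf (σ u), ← lintegral_add_left (by fun_prop)]
      have := S.measurable_comp_right hf (σ u)
      rw [← lintegral_const_mul _ (by fun_prop)]
      refine lintegral_mono fun x => ?_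
      have hab : ∀ a b : ℝ≥0∞, a * b ≤ a ^ 2 + b ^ 2 := fun a b => by
        rcases le_total a b with h | h
        · calc a * b ≤ b * b := by gcongr
            _ ≤ _ := by rw [← sq]; exact le_add_self
        · calc a * b ≤ a * a := by gcongr
            _ ≤ _ := by rw [← sq]; exact le_self_add
      simp only [enorm_mul, RCLike.enorm_conj]
      rw [mul_left_comm]
      gcongr
      exact hab _ _
    · rw [lintegral_mul_const _ hc.enorm]
      refine ENNReal.mul_lt_top hci.2 ?_
      rw [← eLpNorm_two_sq, ← eLpNorm_two_sq]
      exact ENNReal.add_lt_top.2 ⟨ENNReal.pow_lt_top hg2.2, ENNReal.pow_lt_top hf2.2⟩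
  have hL := key hf hf2 hg hg2 hτ
  have hR := key hg hg2 hf hf2 hτ.neg
  have hR' : Integrable (fun p : X × Ω => c p.2 * (conj (S.comp (-τ p.2) g p.1) * f p.1))
      (m.prod μ) := by
    have hm : Measurable fun p : X × Ω => S.comp (-τ p.2) g p.1 :=
      (S.measurable_comp_uncurry hg hτ.neg).comp measurable_swap
    refine hR.mono (Measurable.aestronglyMeasurable (by fun_prop))
      (Eventually.of_forall fun p => le_of_eq ?_)
    simp only [norm_mul, RCLike.norm_conj, Pi.neg_apply]
    ring
  calc ∫ x, conj (g x) * S.avg μ c τ f x ∂m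
      = ∫ x, ∫ u, conj (g x) * (c u * S.comp (τ u) f x) ∂μ ∂m := by
        simp only [avg, integral_const_mul]
    _ = ∫ u, ∫ x, conj (g x) * (c u * S.comp (τ u) f x) ∂m ∂μ := integral_integral_swap hL
    _ = ∫ u, ∫ x, c u * (conj (S.comp (-τ u) g x) * f x) ∂m ∂μ := by
        refine integral_congr_ae (Eventually.of_forall fun u => ?_)
        simp only [mul_left_comm _ (c u), integral_const_mul]
        rw [S.integral_conj_mul_comp hf hg]
    _ = ∫ x, ∫ u, c u * (conj (S.comp (-τ u) g x) * f x) ∂μ ∂m := (integral_integral_swap hR').symm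
    _ = _ := by
        refine integral_congr_ae (Eventually.of_forall fun x => ?_)
        simp only [avg]
        rw [← integral_conj, ← integral_mul_const]
        simp only [map_mul, Complex.conj_conj, mul_assoc]

end Average

end WeightedAction

section Translation

open FourierTransform RealInnerProductSpace

variable {E : Type*} [NormedAddCommGroup E] [InnerProductSpace ℝ E] [FiniteDimensional ℝ E]
  [MeasurableSpace E] [BorelSpace E]

/-- The translation action of a Euclidean space on itself, with trivial weight. -/
noncomputable def translationAction (E : Type*) [NormedAddCommGroup E] [InnerProductSpace ℝ E]
    [FiniteDimensional ℝ E] [MeasurableSpace E] [BorelSpace E] :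
    WeightedAction E (volume : Measure E) where
  act t x := x + t
  weight _ := 1
  measurable_act := by fun_prop
  measurable_weight := by fun_prop
  act_zero := add_zero
  act_add s t x := by abel
  weight_pos _ := one_pos
  weight_add _ _ := (one_mul 1).symm
  lintegral_act t F _ := by
    simpa using lintegral_add_right_eq_self F t

variable {Ω : Type*} [MeasurableSpace Ω] {μ : Measure Ω} [SFinite μ] {c : Ω → ℂ} {τ : Ω → E}

theorem integrable_prod_translate (hc : Measurable c) (hci : Integrable c μ) (hτ : Measurable τ)
    {F : E → ℂ} (hF : Measurable F) (hF1 : Integrable F) :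
    Integrable (fun p : E × Ω => c p.2 * F (p.1 + τ p.2)) (volume.prod μ) := by
  refine ⟨Measurable.aestronglyMeasurable (by fun_prop), ?_⟩
  rw [HasFiniteIntegral, lintegral_prod_symm' _ (by fun_prop)]
  simp only [enorm_mul]
  calc _ = ∫⁻ u, ‖c u‖ₑ * (∫⁻ t, ‖F t‖ₑ) ∂μ := by
        refine lintegral_congr fun u => ?_
        rw [lintegral_const_mul _ (by fun_prop), lintegral_add_right_eq_self (fun t => ‖F t‖ₑ)]
    _ < ∞ := by
        rw [lintegral_mul_const _ hc.enorm]
        exact ENNReal.mul_lt_top hci.2 hF1.2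

theorem fourier_average_translate (hc : Measurable c) (hci : Integrable c μ) (hτ : Measurable τ)
    {F : E → ℂ} (hF : Measurable F) (hF1 : Integrable F) (s : E) :
    𝓕 (fun t => ∫ u, c u * F (t + τ u) ∂μ) s =
      (∫ u, c u * cexp (-(I * (⟪τ u, (-(2 * Real.pi)) • s⟫ : ℝ))) ∂μ) * 𝓕 F s := by
  have hprod := integrable_prod_translate hc hci hτ hF hF1
  have hswap : Integrable (fun p : E × Ω =>
      Real.fourierChar (-⟪p.1, s⟫) • (c p.2 * F (p.1 + τ p.2))) (volume.prod μ) := by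
    refine hprod.mono (AEStronglyMeasurable.smul ?_ hprod.1)
      (Eventually.of_forall fun p => by simp)
    have h : Continuous fun t : E => (Real.fourierChar (-⟪t, s⟫) : ℂ) :=
      continuous_subtype_val.comp
        (Real.continuous_fourierChar.comp (continuous_id.inner continuous_const).neg)
    exact (h.stronglyMeasurable.comp_measurable measurable_fst).aestronglyMeasurable
  have hshift (u : Ω) : ∫ t, Real.fourierChar (-⟪t, s⟫) • F (t + τ u) =
      Real.fourierChar ⟪τ u, s⟫ • 𝓕 F s :=
    congrFun (VectorFourier.fourierIntegral_comp_add_right Real.fourierChar volume (innerₗ E) F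
      (τ u)) s
  calc 𝓕 (fun t => ∫ u, c u * F (t + τ u) ∂μ) s
      = ∫ t, ∫ u, Real.fourierChar (-⟪t, s⟫) • (c u * F (t + τ u)) ∂μ := by
        simp only [Real.fourier_eq, Circle.smul_def, integral_smul]
    _ = ∫ u, (∫ t, Real.fourierChar (-⟪t, s⟫) • (c u * F (t + τ u))) ∂μ := integral_integral_swap hswap
    _ = ∫ u, c u * (Real.fourierChar ⟪τ u, s⟫ • 𝓕 F s) ∂μ := by
        refine integral_congr_ae (Eventually.of_forall fun u => ?_)
        simp only [← mul_smul_comm, integral_const_mul, hshift]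
    _ = _ := by
        rw [← integral_mul_const]
        refine integral_congr_ae (Eventually.of_forall fun u => ?_)
        simp only [Circle.smul_def, Real.fourierChar_apply, smul_eq_mul, ← mul_assoc,
          inner_smul_right]
        push_cast
        ring_nf

theorem lintegral_average_translate_sub_ge (hc : Measurable c) (hci : Integrable c μ)
    (hτ : Measurable τ) {z : ℂ} {d : ℝ}
    (hd : ∀ s, d ≤ ‖∫ u, c u * cexp (-(I * (⟪τ u, s⟫ : ℝ))) ∂μ - z‖)
    {F : E → ℂ} (hF : Measurable F) (hF1 : Integrable F) (hF2 : MemLp F 2) :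
    ENNReal.ofReal d ^ 2 * ∫⁻ t, ‖F t‖ₑ ^ 2 ≤
      ∫⁻ t, ‖∫ u, c u * F (t + τ u) ∂μ - z * F t‖ₑ ^ 2 := by
  have hprod := integrable_prod_translate hc hci hτ hF hF1
  have hG1 : Integrable fun t => ∫ u, c u * F (t + τ u) ∂μ := hprod.integral_prod_left
  have hG2 : MemLp (fun t => ∫ u, c u * F (t + τ u) ∂μ) 2 := by
    have h := (translationAction E).memLp_avg hc hci hτ hF hF2
    have e : (translationAction E).avg μ c τ F = fun t => ∫ u, c u * F (t + τ u) ∂μ := by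
      ext t
      simp [WeightedAction.avg, WeightedAction.comp, translationAction]
    rwa [e] at h
  have hsub : 𝓕 (fun t => ∫ u, c u * F (t + τ u) ∂μ - z * F t) =
      fun s => ((∫ u, c u * cexp (-(I * (⟪τ u, (-(2 * Real.pi)) • s⟫ : ℝ))) ∂μ) - z) * 𝓕 F s := by
    ext s
    rw [sub_mul, ← fourier_average_translate hc hci hτ hF hF1 s]
    simp only [Real.fourier_eq, smul_sub]
    rw [integral_sub]
    · simp only [← mul_smul_comm, integral_const_mul]
    · exact (Real.fourierIntegral_convergent_iff s).2 hG1
    · exact (Real.fourierIntegral_convergent_iff s).2 (hF1.const_mul z)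
  have hP := lintegral_enorm_fourier_sq (hG1.sub (hF1.const_mul z)) (hG2.sub (hF2.const_mul z))
  simp only [Pi.sub_def] at hP
  rw [← hP, ← lintegral_enorm_fourier_sq hF1 hF2, hsub, ← lintegral_const_mul' _ _ (by simp)]
  refine lintegral_mono fun s => ?_
  rw [enorm_mul, mul_pow]
  gcongr
  rw [← ofReal_norm]
  exact ENNReal.ofReal_le_ofReal (hd _)

theorem integrable_exp_neg_mul_norm {ε : ℝ} (hε : 0 < ε) :
    Integrable fun t : E => Real.exp (-(ε * ‖t‖)) := by
  set k := Module.finrank ℝ E + 1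
  have h := integrable_one_add_norm (E := E) (μ := volume) (r := k) (by simp [k])
  refine (h.const_mul (k.factorial / ε ^ k * Real.exp ε)).mono' (by fun_prop)
    (Eventually.of_forall fun t => ?_)
  rw [Real.norm_eq_abs, Real.abs_exp, Real.rpow_neg (by positivity), Real.rpow_natCast]
  have h2 := Real.pow_div_factorial_le_exp (x := ε * (1 + ‖t‖)) (by positivity) k
  rw [mul_pow] at h2
  have e : Real.exp (-(ε * ‖t‖)) = Real.exp ε * (Real.exp (ε * (1 + ‖t‖)))⁻¹ := by
    rw [← Real.exp_neg, ← Real.exp_add]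
    ring_nf
  rw [e]
  have h3 : 0 < ε ^ k * (1 + ‖t‖) ^ k / k.factorial := by positivity
  calc _ ≤ Real.exp ε * (ε ^ k * (1 + ‖t‖) ^ k / k.factorial)⁻¹ := by gcongr
    _ = _ := by
      field_simp

end Translation

theorem Real.abs_exp_sub_one_le_exp_sub_one {x y : ℝ} (h : |x| ≤ y) :
    |Real.exp x - 1| ≤ Real.exp y - 1 := by
  obtain ⟨h1, h2⟩ := abs_le.1 h
  rw [abs_le]
  have h3 := Real.add_one_le_exp x
  have h4 := Real.add_one_le_exp y
  have h5 := Real.exp_le_exp.2 h2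
  constructor <;> linarith

theorem memLp_two_of_lintegral_sq {X : Type*} [MeasurableSpace X] {m : Measure X} {f : X → ℂ}
    (hf : Measurable f) (h : ∫⁻ x, ‖f x‖ₑ ^ 2 ∂m < ∞) : MemLp f 2 m := by
  refine ⟨hf.aestronglyMeasurable, ?_⟩
  rw [← eLpNorm_two_sq] at h
  exact (ENNReal.pow_lt_top_iff.1 h).resolve_right (by norm_num)

namespace WeightedAction

section LowerBound

open RealInnerProductSpace

variable {E : Type*} [NormedAddCommGroup E] [InnerProductSpace ℝ E] [FiniteDimensional ℝ E]
  [MeasurableSpace E] [BorelSpace E] {X Ω : Type*} [MeasurableSpace X] [MeasurableSpace Ω]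
  {m : Measure X} [SFinite m] (S : WeightedAction E m) {μ : Measure Ω} [SFinite μ]
  {c : Ω → ℂ} {τ : Ω → E}

theorem lintegral_prod_mul_comp_sq {b : E → ℂ} (hb : Measurable b) {f : X → ℂ} (hf : Measurable f)
    (s : E) :
    ∫⁻ p : E × X, ‖b p.1 * S.comp (p.1 + s) f p.2‖ₑ ^ 2 ∂(volume.prod m) =
      (∫⁻ t, ‖b t‖ₑ ^ 2) * ∫⁻ x, ‖f x‖ₑ ^ 2 ∂m := by
  have hm : Measurable fun p : E × X => S.comp (p.1 + s) f p.2 :=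
    S.measurable_comp_uncurry hf (measurable_id.add_const s)
  have h1 : Measurable fun p : E × X => ‖b p.1 * S.comp (p.1 + s) f p.2‖ₑ ^ 2 := by fun_prop
  rw [lintegral_prod _ h1.aemeasurable, ← lintegral_mul_const _ (by fun_prop)]
  refine lintegral_congr fun t => ?_
  simp only [enorm_mul, mul_pow]
  rw [lintegral_const_mul _ (((S.measurable_comp_right hf _).enorm).pow_const 2),
    S.lintegral_comp_sq hf]

theorem lintegral_prod_average_ge (hc : Measurable c) (hci : Integrable c μ)
    (hτ : Measurable τ) {z : ℂ} {d : ℝ}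
    (hd : ∀ s, d ≤ ‖∫ u, c u * cexp (-(I * (⟪τ u, s⟫ : ℝ))) ∂μ - z‖)
    {p : E → ℂ} (hp : Measurable p) (hp1 : ∀ t, ‖p t‖ ≤ 1) (hp2 : MemLp p 2)
    {f : X → ℂ} (hf : Measurable f) (hf2 : MemLp f 2 m) :
    ENNReal.ofReal d ^ 2 * ((∫⁻ t, ‖p t ^ 2‖ₑ ^ 2) * ∫⁻ x, ‖f x‖ₑ ^ 2 ∂m) ≤
      ∫⁻ q : E × X, ‖∫ u, c u * (p (q.1 + τ u) ^ 2 * S.comp (q.1 + τ u) f q.2) ∂μ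
        - z * (p q.1 ^ 2 * S.comp q.1 f q.2)‖ₑ ^ 2 ∂(volume.prod m) := by
  have hm : Measurable fun q : E × X => S.comp q.1 f q.2 := S.measurable_comp hf
  have hDm : Measurable fun q : E × X =>
      ∫ u, c u * (p (q.1 + τ u) ^ 2 * S.comp (q.1 + τ u) f q.2) ∂μ := by
    have h1 : Measurable fun r : (E × X) × Ω => S.comp (r.1.1 + τ r.2) f r.1.2 :=
      hm.comp (f := fun r : (E × X) × Ω => (r.1.1 + τ r.2, r.1.2)) (by fun_prop)
    have h2 : Measurable fun r : (E × X) × Ω =>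
      c r.2 * (p (r.1.1 + τ r.2) ^ 2 * S.comp (r.1.1 + τ r.2) f r.1.2) := by fun_prop
    exact h2.stronglyMeasurable.integral_prod_right'.measurable
  have hfib : ∀ᵐ x ∂m, ∫⁻ t, ‖p t * S.comp t f x‖ₑ ^ 2 < ∞ := by
    have h := S.lintegral_prod_mul_comp_sq hp hf 0
    simp only [add_zero] at h
    have hm2 : Measurable fun q : E × X => ‖p q.1 * S.comp q.1 f q.2‖ₑ ^ 2 := by fun_prop
    rw [lintegral_prod_symm _ hm2.aemeasurable, ← eLpNorm_two_sq, ← eLpNorm_two_sq] at h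
    refine ae_lt_top hm2.lintegral_prod_left' ?_
    rw [h]
    exact ENNReal.mul_ne_top (ENNReal.pow_ne_top hp2.2.ne) (ENNReal.pow_ne_top hf2.2.ne)
  have h := S.lintegral_prod_mul_comp_sq (hp.pow_const 2) hf 0
  simp only [add_zero] at h
  rw [← h, lintegral_prod_symm _ (Measurable.aemeasurable (by fun_prop)),
    lintegral_prod_symm _ (Measurable.aemeasurable (by fun_prop)),
    ← lintegral_const_mul' _ _ (by simp)]
  refine lintegral_mono_ae ?_
  filter_upwards [hfib] with x hx
  have hmx : Measurable fun t => S.comp t f x := hm.comp measurable_prodMk_right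
  have h2 : MemLp (fun t => p t * S.comp t f x) 2 := memLp_two_of_lintegral_sq (by fun_prop) hx
  have e : (fun t => p t ^ 2 * S.comp t f x) = fun t => p t * (p t * S.comp t f x) := by
    ext t; ring
  have hF1 : Integrable fun t => p t ^ 2 * S.comp t f x := by
    rw [e]; exact hp2.integrable_mul h2
  have hF2 : MemLp (fun t => p t ^ 2 * S.comp t f x) 2 := by
    refine h2.mono (Measurable.aestronglyMeasurable (by fun_prop)) (Eventually.of_forall fun t => ?_)
    rw [congrFun e t, norm_mul]
    exact mul_le_of_le_one_left (norm_nonneg _) (hp1 t)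
  exact lintegral_average_translate_sub_ge hc hci hτ hd (by fun_prop) hF1 hF2

theorem eLpNorm_integral_commutator_le (hc : Measurable c) (hτ : Measurable τ)
    {g : E → ℂ} (hgm : Measurable g) {δ : E → ℝ≥0∞} (hδ : Measurable δ)
    (hgδ : ∀ s, ∫⁻ t, ‖g (t + s) - g t‖ₑ ^ 2 ≤ δ s * ∫⁻ t, ‖g t‖ₑ ^ 2)
    {κ : ℝ≥0∞} (hκ : κ ^ 2 = (∫⁻ u, ‖c u‖ₑ ∂μ) * ∫⁻ u, ‖c u‖ₑ * δ (τ u) ∂μ)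
    {f : X → ℂ} (hf : Measurable f) :
    eLpNorm (fun q : E × X => ∫ u, c u * ((g (q.1 + τ u) - g q.1) * S.comp (q.1 + τ u) f q.2) ∂μ) 2
      (volume.prod m) ≤ κ * (eLpNorm g 2 volume * eLpNorm f 2 m) := by
  have hcomp : Measurable fun q : E × X => S.comp q.1 f q.2 := S.measurable_comp hf
  have hq0 : Measurable fun r : Ω × (E × X) => S.comp (r.2.1 + τ r.1) f r.2.2 :=
    hcomp.comp (f := fun r : Ω × (E × X) => (r.2.1 + τ r.1, r.2.2)) (by fun_prop)
  have hg1 : Measurable fun r : Ω × (E × X) => g (r.2.1 + τ r.1) - g r.2.1 := by fun_prop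
  have hq1 : Measurable fun r : Ω × (E × X) =>
      (g (r.2.1 + τ r.1) - g r.2.1) * S.comp (r.2.1 + τ r.1) f r.2.2 := hg1.mul hq0
  rw [← ENNReal.pow_le_pow_left_iff two_ne_zero, mul_pow, mul_pow, eLpNorm_two_sq, hκ, mul_assoc]
  refine (lintegral_enorm_integral_sq_le (μ := μ) (m := (volume : Measure E).prod m) hc
    (q := fun u r => (g (r.1 + τ u) - g r.1) * S.comp (r.1 + τ u) f r.2)
    hq1).trans ?_
  refine mul_le_mul_right ?_ _
  rw [← lintegral_mul_const _ (by fun_prop)]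
  refine lintegral_mono fun u => ?_
  have e := S.lintegral_prod_mul_comp_sq (b := fun t => g (t + τ u) - g t) (by fun_prop) hf (τ u)
  rw [e, mul_assoc, ← mul_assoc (δ (τ u)), eLpNorm_two_sq, eLpNorm_two_sq]
  exact mul_le_mul_right (mul_le_mul_left (hgδ (τ u)) _) _

/-- Transference: multiplying the orbit functions by a slowly varying function on the group
reduces the lower bound to the one for translations, up to a small error. -/
theorem eLpNorm_avg_sub_ge_of_slowly_varying (hc : Measurable c) (hci : Integrable c μ)
    (hτ : Measurable τ) {z : ℂ} {d : ℝ}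
    (hd : ∀ s, d ≤ ‖∫ u, c u * cexp (-(I * (⟪τ u, s⟫ : ℝ))) ∂μ - z‖)
    {p g : E → ℂ} (hpm : Measurable p) (hp1 : ∀ t, ‖p t‖ ≤ 1) (hp2 : MemLp p 2)
    (hgp : ∀ t, g t = p t ^ 2) (hg0 : eLpNorm g 2 volume ≠ 0) {δ : E → ℝ≥0∞} (hδ : Measurable δ)
    (hgδ : ∀ s, ∫⁻ t, ‖g (t + s) - g t‖ₑ ^ 2 ≤ δ s * ∫⁻ t, ‖g t‖ₑ ^ 2)
    {κ : ℝ≥0∞} (hκ : κ ^ 2 = (∫⁻ u, ‖c u‖ₑ ∂μ) * ∫⁻ u, ‖c u‖ₑ * δ (τ u) ∂μ)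
    {f : X → ℂ} (hf : Measurable f) (hf2 : MemLp f 2 m) :
    ENNReal.ofReal d * eLpNorm f 2 m ≤ eLpNorm (fun x => S.avg μ c τ f x - z * f x) 2 m +
      κ * eLpNorm f 2 m := by
  have hgm : Measurable g := by
    rw [funext hgp]; exact hpm.pow_const 2
  have hg2 : MemLp g 2 := hp2.mono hgm.aestronglyMeasurable (Eventually.of_forall fun t => by
    rw [hgp, norm_pow]; exact pow_le_of_le_one (norm_nonneg _) (hp1 t) two_ne_zero)
  have hcomp : Measurable fun q : E × X => S.comp q.1 f q.2 := S.measurable_comp hf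
  set h : X → ℂ := fun x => S.avg μ c τ f x - z * f x with hh
  have hhm : Measurable h := (S.measurable_avg hc hτ hf).sub (hf.const_mul z)
  set R : E × X → ℂ := fun q => g q.1 * S.comp q.1 h q.2 with hR
  set W : E × X → ℂ := fun q => ∫ u, c u * ((g (q.1 + τ u) - g q.1) * S.comp (q.1 + τ u) f q.2) ∂μ
    with hW
  have hq0 : Measurable fun r : Ω × (E × X) => S.comp (r.2.1 + τ r.1) f r.2.2 :=
    hcomp.comp (f := fun r : Ω × (E × X) => (r.2.1 + τ r.1, r.2.2)) (by fun_prop)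
  have hK : (∫⁻ t, ‖g t‖ₑ ^ 2) * ∫⁻ x, ‖f x‖ₑ ^ 2 ∂m ≠ ∞ := by
    rw [← eLpNorm_two_sq, ← eLpNorm_two_sq]
    exact ENNReal.mul_ne_top (ENNReal.pow_ne_top hg2.2.ne) (ENNReal.pow_ne_top hf2.2.ne)
  have hI1 := ae_integrable_mul (m := (volume : Measure E).prod m) hc hci
    (q := fun u r => g r.1 * S.comp (r.1 + τ u) f r.2)
    ((hgm.comp (measurable_fst.comp measurable_snd)).mul hq0) hK
    (fun u => (S.lintegral_prod_mul_comp_sq hgm hf (τ u)).le)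
  have hI2 := ae_integrable_mul (m := (volume : Measure E).prod m) hc hci
    (q := fun u r => g (r.1 + τ u) * S.comp (r.1 + τ u) f r.2)
    ((hgm.comp (f := fun r : Ω × (E × X) => r.2.1 + τ r.1) (by fun_prop)).mul hq0) hK
    (fun u => (by
      rw [S.lintegral_prod_mul_comp_sq (b := fun t => g (t + τ u)) (by fun_prop) hf (τ u),
        lintegral_add_right_eq_self (fun t => ‖g t‖ₑ ^ 2) (τ u)]))
  have hD : ∀ᵐ q ∂(volume : Measure E).prod m,
      ∫ u, c u * (g (q.1 + τ u) * S.comp (q.1 + τ u) f q.2) ∂μ - z * (g q.1 * S.comp q.1 f q.2)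
        = R q + W q := by
    filter_upwards [hI1, hI2] with q h1 h2
    have e1 : S.comp q.1 h q.2 = S.comp q.1 (S.avg μ c τ f) q.2 - z * S.comp q.1 f q.2 := by
      simp only [comp, hh]; ring
    have e2 : W q = ∫ u, c u * (g (q.1 + τ u) * S.comp (q.1 + τ u) f q.2) ∂μ -
        g q.1 * S.comp q.1 (S.avg μ c τ f) q.2 := by
      rw [S.comp_avg, ← integral_const_mul]
      simp only [mul_left_comm (g q.1)]
      rw [← integral_sub h2 h1]
      simp only [hW, sub_mul, mul_sub]
    have e3 : R q = g q.1 * S.comp q.1 h q.2 := rfl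
    rw [e2, e3, e1]
    ring
  have hWm : Measurable W := by
    have h2 : Measurable fun r : (E × X) × Ω => c r.2 * ((g (r.1.1 + τ r.2) - g r.1.1) *
        S.comp (r.1.1 + τ r.2) f r.1.2) := by
      have : Measurable fun r : (E × X) × Ω => S.comp (r.1.1 + τ r.2) f r.1.2 :=
        hq0.comp measurable_swap
      fun_prop
    exact h2.stronglyMeasurable.integral_prod_right'.measurable
  have hRm : Measurable R := (hgm.comp measurable_fst).mul (S.measurable_comp hhm)
  have bR : eLpNorm R 2 (volume.prod m) = eLpNorm g 2 volume * eLpNorm h 2 m := by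
    have h1 := S.lintegral_prod_mul_comp_sq hgm hhm 0
    simp only [add_zero] at h1
    rw [← eLpNorm_two_sq, ← eLpNorm_two_sq, ← eLpNorm_two_sq, ← mul_pow] at h1
    exact le_antisymm ((ENNReal.pow_le_pow_left_iff two_ne_zero).1 h1.le)
      ((ENNReal.pow_le_pow_left_iff two_ne_zero).1 h1.ge)
  have bW : eLpNorm W 2 (volume.prod m) ≤ κ * (eLpNorm g 2 volume * eLpNorm f 2 m) :=
    S.eLpNorm_integral_commutator_le hc hτ hgm hδ hgδ hκ hf
  have bD : ENNReal.ofReal d * (eLpNorm g 2 volume * eLpNorm f 2 m) ≤ eLpNorm (R + W) 2 (volume.prod m) := by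
    rw [← ENNReal.pow_le_pow_left_iff two_ne_zero, mul_pow, mul_pow, eLpNorm_two_sq,
      eLpNorm_two_sq, eLpNorm_two_sq]
    simp only [hgp]
    refine (S.lintegral_prod_average_ge hc hci hτ hd hpm hp1 hp2 hf hf2).trans_eq ?_
    refine lintegral_congr_ae ?_
    filter_upwards [hD] with q hq
    simp only [hgp] at hq
    rw [hq, Pi.add_apply]
  have final : eLpNorm g 2 volume * (ENNReal.ofReal d * eLpNorm f 2 m) ≤
      eLpNorm g 2 volume * (eLpNorm h 2 m + κ * eLpNorm f 2 m) := by
    calc _ = ENNReal.ofReal d * (eLpNorm g 2 volume * eLpNorm f 2 m) := by ring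
      _ ≤ eLpNorm R 2 (volume.prod m) + eLpNorm W 2 (volume.prod m) :=
        bD.trans (eLpNorm_add_le hRm.aestronglyMeasurable hWm.aestronglyMeasurable (by norm_num))
      _ ≤ eLpNorm g 2 volume * eLpNorm h 2 m + κ * (eLpNorm g 2 volume * eLpNorm f 2 m) := by rw [bR]; gcongr
      _ = _ := by ring
  exact (ENNReal.mul_le_mul_iff_right hg0 hg2.2.ne).1 final

theorem eLpNorm_avg_sub_ge_of_pos (hc : Measurable c) (hci : Integrable c μ)
    (hτ : Measurable τ) {z : ℂ} {d : ℝ}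
    (hd : ∀ s, d ≤ ‖∫ u, c u * cexp (-(I * (⟪τ u, s⟫ : ℝ))) ∂μ - z‖)
    {f : X → ℂ} (hf : Measurable f) (hf2 : MemLp f 2 m) {ε : ℝ} (hε : 0 < ε) :
    ENNReal.ofReal d * eLpNorm f 2 m ≤ eLpNorm (fun x => S.avg μ c τ f x - z * f x) 2 m +
      ((∫⁻ u, ‖c u‖ₑ ∂μ) * ∫⁻ u, ‖c u‖ₑ *
        ENNReal.ofReal (min 4 ((Real.exp (ε * (2 * ‖τ u‖)) - 1) ^ 2)) ∂μ) ^ (1 / 2 : ℝ) *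
        eLpNorm f 2 m := by
  set p : E → ℂ := fun t => (Real.exp (-(ε * ‖t‖)) : ℝ) with hp
  have hpm : Measurable p := Continuous.measurable (by fun_prop)
  have hpn (t : E) : ‖p t‖ = Real.exp (-(ε * ‖t‖)) := by
    rw [hp, Complex.norm_real, Real.norm_eq_abs, Real.abs_exp]
  have hp1 (t : E) : ‖p t‖ ≤ 1 := by
    rw [hpn, Real.exp_le_one_iff, Left.neg_nonpos_iff]; positivity
  have hp2 : MemLp p 2 := by
    rw [memLp_two_iff_integrable_sq_norm hpm.aestronglyMeasurable]
    refine (integrable_exp_neg_mul_norm (E := E) (ε := 2 * ε) (by positivity)).congr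
      (Eventually.of_forall fun t => ?_)
    simp only [hpn]
    rw [← Real.exp_nat_mul]
    ring_nf
  set g : E → ℂ := fun t => p t ^ 2 with hg
  have hgm : Measurable g := hpm.pow_const 2
  have hg0 : eLpNorm g 2 volume ≠ 0 := by
    rw [Ne, eLpNorm_eq_zero_iff hgm.aestronglyMeasurable (by norm_num)]
    intro h0
    obtain ⟨t, ht⟩ := h0.exists
    simp [hg, hp] at ht
  have hgdiff (s : E) : ∫⁻ t, ‖g (t + s) - g t‖ₑ ^ 2 ≤
      ENNReal.ofReal (min 4 ((Real.exp (ε * (2 * ‖s‖)) - 1) ^ 2)) * ∫⁻ t, ‖g t‖ₑ ^ 2 := by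
    refine lintegral_enorm_sub_sq_le (by fun_prop)
      (lintegral_add_right_eq_self (fun t => ‖g t‖ₑ ^ 2) s) (Eventually.of_forall fun t => ?_)
    have e : g (t + s) - g t = ((Real.exp (-(2 * ε) * (‖t + s‖ - ‖t‖)) - 1 : ℝ) : ℂ) * g t := by
      simp only [hg, hp]
      norm_cast
      rw [← Real.exp_nat_mul, ← Real.exp_nat_mul, sub_mul, ← Real.exp_add]
      push_cast
      ring_nf
    rw [e, norm_mul, Complex.norm_real]
    gcongr
    refine Real.abs_exp_sub_one_le_exp_sub_one ?_
    rw [abs_mul, abs_neg, abs_of_pos (by positivity : (0 : ℝ) < 2 * ε)]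
    have := abs_norm_sub_norm_le (t + s) t
    rw [add_sub_cancel_left] at this
    nlinarith
  refine S.eLpNorm_avg_sub_ge_of_slowly_varying hc hci hτ hd hpm hp1 hp2 (fun t => rfl) hg0
    (δ := fun s => ENNReal.ofReal (min 4 ((Real.exp (ε * (2 * ‖s‖)) - 1) ^ 2))) (by fun_prop) hgdiff
    ?_ hf hf2
  rw [← ENNReal.rpow_natCast, ← ENNReal.rpow_mul]
  norm_num

theorem eLpNorm_avg_sub_ge (hc : Measurable c) (hci : Integrable c μ)
    (hτ : Measurable τ) {z : ℂ} {d : ℝ}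
    (hd : ∀ s, d ≤ ‖∫ u, c u * cexp (-(I * (⟪τ u, s⟫ : ℝ))) ∂μ - z‖)
    {f : X → ℂ} (hf : Measurable f) (hf2 : MemLp f 2 m) :
    ENNReal.ofReal d * eLpNorm f 2 m ≤ eLpNorm (fun x => S.avg μ c τ f x - z * f x) 2 m := by
  have h1 := tendsto_lintegral_min_exp_sub_one hc hci (N := fun u => 2 * ‖τ u‖) (by fun_prop)
  have h2 := ENNReal.Tendsto.const_mul (a := ∫⁻ u, ‖c u‖ₑ ∂μ) h1 (Or.inr hci.2.ne)
  have h3 := (ENNReal.continuous_rpow_const (y := (1 / 2 : ℝ))).tendsto _ |>.comp h2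
  have h4 := ENNReal.Tendsto.mul_const h3 (b := eLpNorm f 2 m) (Or.inr hf2.2.ne)
  have h5 := h4.const_add (eLpNorm (fun x => S.avg μ c τ f x - z * f x) 2 m)
  rw [mul_zero, ENNReal.zero_rpow_of_pos (by norm_num), zero_mul, add_zero] at h5
  exact ge_of_tendsto' h5 fun k => S.eLpNorm_avg_sub_ge_of_pos hc hci hτ hd hf hf2 (by positivity)

end LowerBound

end WeightedAction

section HilbertSpectrum

open InnerProductSpace

variable {H : Type*} [NormedAddCommGroup H] [InnerProductSpace ℂ H] [CompleteSpace H]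

theorem ContinuousLinearMap.notMem_spectrum_of_le_norm_sub (T : H →L[ℂ] H) {z : ℂ} {d : ℝ}
    (hd : 0 < d) (h : ∀ x, d * ‖x‖ ≤ ‖T x - z • x‖)
    (hadj : ∀ x, ContinuousLinearMap.adjoint T x = conj z • x → x = 0) : z ∉ spectrum ℂ T := by
  rw [spectrum.notMem_iff, ContinuousLinearMap.isUnit_iff_bijective,
    ContinuousLinearMap.bijective_iff_dense_range_and_antilipschitz]
  refine ⟨?_, ⟨Real.toNNReal d⁻¹, ContinuousLinearMap.antilipschitz_of_bound _ fun x => ?_⟩⟩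
  · rw [Submodule.topologicalClosure_eq_top_iff, Submodule.eq_bot_iff]
    intro x hx
    refine hadj x ?_
    refine ext_inner_right ℂ fun y => ?_
    have h1 := hx _ ⟨y, rfl⟩
    have h2 : inner ℂ x (z • y - T y) = 0 := by
      rw [← inner_conj_symm, map_eq_zero]
      exact h1
    rw [ContinuousLinearMap.adjoint_inner_left, inner_smul_left, Complex.conj_conj,
      ← inner_smul_right]
    rw [inner_sub_right, sub_eq_zero] at h2
    exact h2.symm
  · have e : (algebraMap ℂ (H →L[ℂ] H) z - T) x = z • x - T x := rfl
    rw [Real.coe_toNNReal _ (by positivity), e, norm_sub_rev, ← div_eq_inv_mul, le_div_iff₀ hd,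
      mul_comm]
    exact h x

theorem ContinuousLinearMap.mem_spectrum_of_forall_norm_sub_le (T : H →L[ℂ] H) {z : ℂ}
    (h : ∀ δ > 0, ∃ x ≠ 0, ‖T x - z • x‖ ≤ δ * ‖x‖) : z ∈ spectrum ℂ T := by
  by_contra hz
  rw [spectrum.notMem_iff, ContinuousLinearMap.isUnit_iff_bijective,
    ContinuousLinearMap.bijective_iff_dense_range_and_antilipschitz] at hz
  obtain ⟨-, K, hK⟩ := hz
  obtain ⟨x, hx0, hx⟩ := h (1 / (K + 1)) (by positivity)
  have h1 := hK.le_mul_dist x 0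
  have e : (algebraMap ℂ (H →L[ℂ] H) z - T) x = z • x - T x := rfl
  rw [map_zero, dist_zero_right, dist_zero_right, e, norm_sub_rev] at h1
  have hpos : 0 < ‖x‖ := norm_pos_iff.2 hx0
  have h2 : ‖x‖ ≤ K * (1 / (K + 1) * ‖x‖) := h1.trans (by gcongr)
  have h3 : K * (1 / (K + 1) * ‖x‖) = ‖x‖ - ‖x‖ / (K + 1) := by
    field_simp
    ring
  have : 0 < ‖x‖ / ((K : ℝ) + 1) := by positivity
  linarith

end HilbertSpectrum

namespace WeightedAction

section Realization

variable {E : Type*} [AddCommGroup E] [MeasurableSpace E] {X Ω : Type*} [MeasurableSpace X]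
  [MeasurableSpace Ω] {m : Measure X} [SFinite m] (S : WeightedAction E m) {μ : Measure Ω}
  [SFinite μ] {c : Ω → ℂ} {τ : Ω → E}

theorem avg_congr_ae (hτ : Measurable τ) {f g : X → ℂ} (hf : Measurable f) (hg : Measurable g)
    (h : f =ᵐ[m] g) : S.avg μ c τ f =ᵐ[m] S.avg μ c τ g := by
  have hset : MeasurableSet {p : Ω × X | S.comp (τ p.1) f p.2 = S.comp (τ p.1) g p.2} :=
    measurableSet_eq_fun (S.measurable_comp_uncurry hf hτ) (S.measurable_comp_uncurry hg hτ)
  have h1 := (Measure.ae_ae_comm (μ := μ) (ν := m) hset).1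
    (Eventually.of_forall fun u => S.comp_congr_ae h (τ u))
  filter_upwards [h1] with x hx
  refine integral_congr_ae ?_
  filter_upwards [hx] with u hu
  rw [hu]

theorem adjoint_ae_eq_avg [MeasurableNeg E] (hc : Measurable c) (hci : Integrable c μ) (hτ : Measurable τ)
    {T : Lp ℂ 2 m →L[ℂ] Lp ℂ 2 m} (hT : ∀ f : Lp ℂ 2 m, T f =ᵐ[m] S.avg μ c τ f) (g : Lp ℂ 2 m) :
    ContinuousLinearMap.adjoint T g =ᵐ[m]
      S.avg μ (fun u => conj (c u)) (fun u => -τ u) g := by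
  have hc' : Measurable fun u => conj (c u) := Complex.continuous_conj.measurable.comp hc
  have hci' : Integrable (fun u => conj (c u)) μ := Complex.conjLIE.integrable_comp_iff.2 hci
  have hg : MemLp (S.avg μ (fun u => conj (c u)) (fun u => -τ u) g) 2 m :=
    S.memLp_avg hc' hci' hτ.neg (Lp.stronglyMeasurable g).measurable (Lp.memLp g)
  have key : ContinuousLinearMap.adjoint T g = hg.toLp _ := by
    refine ext_inner_right ℂ fun f => ?_
    rw [ContinuousLinearMap.adjoint_inner_left, L2.inner_def, L2.inner_def]
    simp only [RCLike.inner_apply']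
    have h := S.integral_conj_mul_avg hc hci hτ (Lp.stronglyMeasurable f).measurable (Lp.memLp f)
      (Lp.stronglyMeasurable g).measurable (Lp.memLp g)
    rw [integral_congr_ae (g := fun x => conj (g x) * S.avg μ c τ f x), h]
    · refine integral_congr_ae ?_
      filter_upwards [hg.coeFn_toLp] with x hx
      rw [hx]
    · filter_upwards [hT f] with x hx
      rw [hx]
  rw [key]
  exact hg.coeFn_toLp

theorem avg_ae_eq_zero_of_not_aestronglyMeasurable (hc : ¬ AEStronglyMeasurable c μ)
    (hτ : Measurable τ) {f : X → ℂ} (hf : Measurable f) (hf0 : ∀ᵐ x ∂m, f x ≠ 0) :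
    S.avg μ c τ f =ᵐ[m] 0 := by
  have hm := S.measurable_comp_uncurry hf hτ
  have hset : MeasurableSet {p : Ω × X | S.comp (τ p.1) f p.2 ≠ 0} :=
    (measurableSet_eq_fun hm measurable_const).compl
  have h0 (u : Ω) : ∀ᵐ x ∂m, S.comp (τ u) f x ≠ 0 := by
    filter_upwards [(S.quasiMeasurePreserving_act (τ u)).ae hf0] with x hx
    exact mul_ne_zero (Complex.ofReal_ne_zero.2 (S.weight_pos _).ne') hx
  have h1 := (Measure.ae_ae_comm (μ := μ) (ν := m) hset).1 (Eventually.of_forall h0)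
  filter_upwards [h1] with x hx
  refine integral_undef fun hi => hc ?_
  have hx' : Measurable fun u => S.comp (τ u) f x := hm.comp measurable_prodMk_right
  refine (hi.1.mul hx'.inv.aestronglyMeasurable).congr ?_
  filter_upwards [hx] with u hu
  exact mul_inv_cancel_right₀ hu _

theorem eq_zero_of_not_aestronglyMeasurable (hc : ¬ AEStronglyMeasurable c μ) (hτ : Measurable τ)
    {T : Lp ℂ 2 m →L[ℂ] Lp ℂ 2 m} (hT : ∀ f : Lp ℂ 2 m, T f =ᵐ[m] S.avg μ c τ f)
    {g : X → ℂ} (hg2 : MemLp g 2 m) (hg0 : ∀ x, g x ≠ 0) : T = 0 := by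
  have h0 (f : Lp ℂ 2 m) (hf : ∀ᵐ x ∂m, f x ≠ 0) : T f = 0 := by
    refine Lp.ext ((hT f).trans ((S.avg_ae_eq_zero_of_not_aestronglyMeasurable hc hτ
      (Lp.stronglyMeasurable f).measurable hf).trans (Lp.coeFn_zero _ _ _).symm))
  ext1 f
  have hs : MeasurableSet {x | f x = 0} :=
    measurableSet_eq_fun (Lp.stronglyMeasurable f).measurable measurable_const
  have hh : MemLp ({x | f x = 0}.indicator g) 2 m := hg2.indicator hs
  have h1 : T (f + hh.toLp _) = 0 := by
    refine h0 _ ?_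
    filter_upwards [Lp.coeFn_add f (hh.toLp _), hh.coeFn_toLp] with x hx1 hx2
    rw [hx1, Pi.add_apply, hx2]
    by_cases hx : f x = 0
    · simp [Set.indicator, hx, hg0 x]
    · simp [Set.indicator, hx]
  have h2 : T (f + (f + hh.toLp _)) = 0 := by
    refine h0 _ ?_
    filter_upwards [Lp.coeFn_add f (f + hh.toLp _), Lp.coeFn_add f (hh.toLp _), hh.coeFn_toLp]
      with x hx0 hx1 hx2
    rw [hx0, Pi.add_apply, hx1, Pi.add_apply, hx2]
    by_cases hx : f x = 0
    · simp [Set.indicator, hx, hg0 x]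
    · simp [Set.indicator, hx, ← two_mul]
  rwa [map_add, h1, add_zero] at h2

/-- Approximate joint eigenfunctions of the action give approximate eigenfunctions of `T`. -/
theorem mem_spectrum_of_forall_norm_comp_sub_le (hc : Measurable c) (hci : Integrable c μ)
    (hτ : Measurable τ) {T : Lp ℂ 2 m →L[ℂ] Lp ℂ 2 m}
    (hT : ∀ f : Lp ℂ 2 m, T f =ᵐ[m] S.avg μ c τ f) {χ : E → ℂ} (hχ : Measurable χ)
    (hχ1 : ∀ t, ‖χ t‖ = 1) {N : E → ℝ} (hN : Measurable N)
    (h : ∀ ε > 0, ∃ f : X → ℂ, Measurable f ∧ MemLp f 2 m ∧ ¬ f =ᵐ[m] 0 ∧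
      ∀ t, ∀ᵐ x ∂m, ‖S.comp t f x - χ t * f x‖ ≤ (Real.exp (ε * N t) - 1) * ‖f x‖) :
    ∫ u, c u * χ (τ u) ∂μ ∈ spectrum ℂ T := by
  refine T.mem_spectrum_of_forall_norm_sub_le fun δ hδ => ?_
  have h1 := tendsto_lintegral_min_exp_sub_one hc hci (N := fun u => N (τ u)) (by fun_prop)
  have h2 := ENNReal.Tendsto.const_mul (a := ∫⁻ u, ‖c u‖ₑ ∂μ) h1 (Or.inr hci.2.ne)
  rw [mul_zero] at h2
  obtain ⟨k, hk⟩ := (h2.eventually_le_const (u := ENNReal.ofReal δ ^ 2)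
    (ENNReal.pow_pos (ENNReal.ofReal_pos.2 hδ) 2)).exists
  obtain ⟨f, hf, hf2, hf0, hfχ⟩ := h (1 / ((k : ℝ) + 1)) (by positivity)
  refine ⟨hf2.toLp f, fun h0 => hf0 ?_, ?_⟩
  · exact hf2.coeFn_toLp.symm.trans (by rw [h0]; exact Lp.coeFn_zero _ _ _)
  have hTf : T (hf2.toLp f) =ᵐ[m] S.avg μ c τ f :=
    (hT _).trans (S.avg_congr_ae hτ (Lp.stronglyMeasurable _).measurable hf hf2.coeFn_toLp)
  set z := ∫ u, c u * χ (τ u) ∂μ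
  have e2 : eLpNorm (T (hf2.toLp f) - z • hf2.toLp f : Lp ℂ 2 m) 2 m =
      eLpNorm (fun x => ∫ u, c u * (S.comp (τ u) f x - χ (τ u) * f x) ∂μ) 2 m := by
    refine eLpNorm_congr_ae ?_
    have hI := ae_integrable_mul (m := m) hc hci
      (q := fun u x => S.comp (τ u) f x) (S.measurable_comp_uncurry hf hτ)
      (K := ∫⁻ x, ‖f x‖ₑ ^ 2 ∂m) (by rw [← eLpNorm_two_sq]; exact ENNReal.pow_ne_top hf2.2.ne)
      (fun u => (S.lintegral_comp_sq hf _).le)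
    have hI2 : Integrable (fun u => c u * χ (τ u)) μ :=
      hci.mono (Measurable.aestronglyMeasurable (by fun_prop))
        (Eventually.of_forall fun u => by rw [norm_mul, hχ1, mul_one])
    filter_upwards [hTf, Lp.coeFn_sub (T (hf2.toLp f)) (z • hf2.toLp f),
      Lp.coeFn_smul z (hf2.toLp f), hf2.coeFn_toLp, hI] with x hx1 hx2 hx3 hx4 hx5
    rw [hx2, Pi.sub_apply, hx3, hx1, Pi.smul_apply, smul_eq_mul, hx4, avg, ← integral_mul_const,
      ← integral_sub hx5 (hI2.mul_const _)]
    refine integral_congr_ae (Eventually.of_forall fun u => ?_)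
    simp only
    ring
  have hq : Measurable fun p : Ω × X => S.comp (τ p.1) f p.2 - χ (τ p.1) * f p.2 := by
    have := S.measurable_comp_uncurry hf hτ
    fun_prop
  have e3 : eLpNorm (T (hf2.toLp f) - z • hf2.toLp f : Lp ℂ 2 m) 2 m ^ 2 ≤
      (ENNReal.ofReal δ * eLpNorm f 2 m) ^ 2 := by
    rw [e2, eLpNorm_two_sq, mul_pow, eLpNorm_two_sq]
    refine (lintegral_enorm_integral_sq_le (m := m) hc
      (q := fun u x => S.comp (τ u) f x - χ (τ u) * f x) hq).trans
      (le_trans ?_ (mul_le_mul_left hk _))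
    rw [mul_assoc]
    refine mul_le_mul_right ?_ _
    rw [← lintegral_mul_const _ (by fun_prop)]
    refine lintegral_mono fun u => ?_
    dsimp only
    rw [mul_assoc]
    refine mul_le_mul_right ?_ _
    have hn : ∫⁻ x, ‖χ (τ u) * f x‖ₑ ^ 2 ∂m = ∫⁻ x, ‖f x‖ₑ ^ 2 ∂m := by
      refine lintegral_congr fun x => ?_
      rw [enorm_mul, ← ofReal_norm (χ _), hχ1, ENNReal.ofReal_one, one_mul]
    rw [← hn]
    refine lintegral_enorm_sub_sq_le (S.measurable_comp_right hf _)
      ((S.lintegral_comp_sq hf _).trans hn.symm) ?_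
    filter_upwards [hfχ (τ u)] with x hx
    rwa [norm_mul, hχ1, one_mul]
  rw [ENNReal.pow_le_pow_left_iff two_ne_zero] at e3
  have e4 := ENNReal.toReal_mono (ENNReal.mul_ne_top ENNReal.ofReal_ne_top hf2.2.ne) e3
  rw [ENNReal.toReal_mul, ENNReal.toReal_ofReal hδ.le] at e4
  rwa [Lp.norm_def, Lp.norm_toLp]

end Realization

section Spectrum

open RealInnerProductSpace

variable {E : Type*} [NormedAddCommGroup E] [InnerProductSpace ℝ E] [FiniteDimensional ℝ E]
  [MeasurableSpace E] [BorelSpace E] {X Ω : Type*} [MeasurableSpace X] [MeasurableSpace Ω]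
  {m : Measure X} [SFinite m] (S : WeightedAction E m) {μ : Measure Ω} [SFinite μ]
  {c : Ω → ℂ} {τ : Ω → E}

theorem le_norm_sub_smul (hc : Measurable c) (hci : Integrable c μ) (hτ : Measurable τ) {z : ℂ}
    {d : ℝ} (hd0 : 0 ≤ d) (hd : ∀ s, d ≤ ‖∫ u, c u * cexp (-(I * (⟪τ u, s⟫ : ℝ))) ∂μ - z‖)
    {f h : Lp ℂ 2 m} (hh : h =ᵐ[m] S.avg μ c τ f) : d * ‖f‖ ≤ ‖h - z • f‖ := by
  have h1 := S.eLpNorm_avg_sub_ge hc hci hτ hd (Lp.stronglyMeasurable f).measurable (Lp.memLp f)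
  have h2 : eLpNorm (fun x => S.avg μ c τ f x - z * f x) 2 m = eLpNorm (h - z • f : Lp ℂ 2 m) 2 m := by
    refine eLpNorm_congr_ae ?_
    filter_upwards [hh, Lp.coeFn_sub h (z • f), Lp.coeFn_smul z f] with x hx1 hx2 hx3
    rw [hx2, Pi.sub_apply, hx3, hx1, Pi.smul_apply, smul_eq_mul]
  rw [h2] at h1
  have h3 := ENNReal.toReal_mono (Lp.eLpNorm_ne_top _) h1
  rwa [ENNReal.toReal_mul, ENNReal.toReal_ofReal hd0] at h3

theorem spectrum_subset (hc : Measurable c) (hci : Integrable c μ) (hτ : Measurable τ)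
    {T : Lp ℂ 2 m →L[ℂ] Lp ℂ 2 m} (hT : ∀ f : Lp ℂ 2 m, T f =ᵐ[m] S.avg μ c τ f) :
    spectrum ℂ T ⊆
      closure (Set.range fun s : E => ∫ u, c u * cexp (-(I * (⟪τ u, s⟫ : ℝ))) ∂μ) := by
  intro z hz
  by_contra hz'
  obtain ⟨d, hd, hball⟩ := Metric.nhds_basis_ball.mem_iff.1 (isClosed_closure.isOpen_compl.mem_nhds hz')
  have hdist (s : E) : d ≤ ‖∫ u, c u * cexp (-(I * (⟪τ u, s⟫ : ℝ))) ∂μ - z‖ := by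
    by_contra! hlt
    exact hball (mem_ball_iff_norm.2 hlt) (subset_closure ⟨s, rfl⟩)
  refine T.notMem_spectrum_of_le_norm_sub hd (fun f => S.le_norm_sub_smul hc hci hτ hd.le hdist (hT f))
    (fun g hg => ?_) hz
  have hc' : Measurable fun u => conj (c u) := Complex.continuous_conj.measurable.comp hc
  have hci' : Integrable (fun u => conj (c u)) μ := Complex.conjLIE.integrable_comp_iff.2 hci
  have hdist' (s : E) :
      d ≤ ‖∫ u, conj (c u) * cexp (-(I * (⟪-τ u, s⟫ : ℝ))) ∂μ - conj z‖ := by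
    have e : ∫ u, conj (c u) * cexp (-(I * (⟪-τ u, s⟫ : ℝ))) ∂μ =
        conj (∫ u, c u * cexp (-(I * (⟪τ u, s⟫ : ℝ))) ∂μ) := by
      rw [← integral_conj]
      refine integral_congr_ae (Eventually.of_forall fun u => ?_)
      simp only [map_mul, ← Complex.exp_conj, map_neg, Complex.conj_I, Complex.conj_ofReal,
        inner_neg_left]
      push_cast
      ring_nf
    rw [e, ← map_sub, Complex.norm_conj]
    exact hdist s
  have h := S.le_norm_sub_smul hc' hci' hτ.neg hd.le hdist' (S.adjoint_ae_eq_avg hc hci hτ hT g)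
  rw [hg, sub_self, norm_zero] at h
  exact norm_le_zero_iff.1 (by nlinarith [norm_nonneg g])

end Spectrum

end WeightedAction

section PowerFunctions

theorem Real.integrable_exp_neg_log_sub_mul_abs_log {ε : ℝ} (hε : 0 < ε) :
    Integrable fun y : ℝ => Real.exp (-Real.log y - ε * |Real.log y|) := by
  have e : (fun y : ℝ => Real.exp (-Real.log y - ε * |Real.log y|)) =
      fun y : ℝ => Real.exp (-Real.log ‖y‖ - ε * |Real.log ‖y‖|) := by
    simp [Real.log_abs]
  rw [e, integrable_fun_norm_addHaar (μ := (volume : Measure ℝ))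
    (f := fun y => Real.exp (-Real.log y - ε * |Real.log y|))]
  simp only [Module.finrank_self, tsub_self, pow_zero, one_smul]
  rw [← Set.Ioo_union_Ici_eq_Ioi (zero_lt_one (α := ℝ)), integrableOn_union,
    integrableOn_Ici_iff_integrableOn_Ioi]
  constructor
  · refine ((intervalIntegral.integrableOn_Ioo_rpow_iff (s := -1 + ε) zero_lt_one).2
      (by linarith)).congr_fun (fun y hy => ?_) measurableSet_Ioo
    simp only
    rw [Real.rpow_def_of_pos hy.1, abs_of_neg (Real.log_neg hy.1 hy.2)]
    ring_nf
  · refine (integrableOn_Ioi_rpow_of_lt (a := -1 - ε) (by linarith) zero_lt_one).congr_fun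
      (fun y hy => ?_) measurableSet_Ioi
    simp only
    rw [Real.rpow_def_of_pos (zero_lt_one.trans hy), abs_of_pos (Real.log_pos hy)]
    ring_nf

variable {n : ℕ}

/-- Products of one-dimensional powers `|y|^(-1/2 - i s)`, damped near zero and infinity. -/
noncomputable def dampedPower (ε : ℝ) (s y : Fin n → ℝ) : ℂ :=
  cexp (∑ j, ((-(1 / 2 : ℂ) - I * s j) * Real.log (y j) - (ε * |Real.log (y j)| : ℝ)))

theorem measurable_dampedPower (ε : ℝ) (s : Fin n → ℝ) : Measurable (dampedPower ε s) := by
  unfold dampedPower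
  fun_prop

theorem dampedPower_ne_zero (ε : ℝ) (s y : Fin n → ℝ) : dampedPower ε s y ≠ 0 :=
  Complex.exp_ne_zero _

theorem memLp_dampedPower {ε : ℝ} (hε : 0 < ε) (s : Fin n → ℝ) : MemLp (dampedPower ε s) 2 := by
  rw [memLp_two_iff_integrable_sq_norm (measurable_dampedPower ε s).aestronglyMeasurable]
  refine (Integrable.fintype_prod (f := fun (_ : Fin n) (y : ℝ) =>
    Real.exp (-Real.log y - 2 * ε * |Real.log y|)) fun _ =>
      Real.integrable_exp_neg_log_sub_mul_abs_log (by positivity)).congr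
      (Eventually.of_forall fun y => ?_)
  simp only
  rw [dampedPower, Complex.norm_exp, ← Real.exp_nat_mul, ← Real.exp_sum, Complex.re_sum,
    Finset.mul_sum]
  congr 1
  refine Finset.sum_congr rfl fun j _ => ?_
  simp
  ring

theorem norm_dampedPower_sub_le {ε : ℝ} (hε : 0 < ε) (s t y : Fin n → ℝ) (hy : ∀ j, y j ≠ 0) :
    ‖(Real.exp ((∑ j, t j) / 2) : ℂ) * dampedPower ε s (fun j => Real.exp (t j) * y j) -
        cexp (-(I * (∑ j, t j * s j : ℝ))) * dampedPower ε s y‖ ≤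
      (Real.exp (ε * ∑ j, |t j|) - 1) * ‖dampedPower ε s y‖ := by
  set r : ℝ := ∑ j, -(ε * (|t j + Real.log (y j)| - |Real.log (y j)|)) with hr
  have e : (Real.exp ((∑ j, t j) / 2) : ℂ) * dampedPower ε s (fun j => Real.exp (t j) * y j) =
      Real.exp r * (cexp (-(I * (∑ j, t j * s j : ℝ))) * dampedPower ε s y) := by
    simp only [dampedPower, Complex.ofReal_exp, ← Complex.exp_add]
    congr 1
    simp only [Real.log_mul (Real.exp_ne_zero _) (hy _), Real.log_exp, hr]
    push_cast
    rw [Finset.sum_div, Finset.mul_sum, ← Finset.sum_neg_distrib, ← Finset.sum_add_distrib,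
      ← Finset.sum_add_distrib, ← Finset.sum_add_distrib]
    refine Finset.sum_congr rfl fun j _ => ?_
    ring
  have h1 : ‖cexp (-(I * (∑ j, t j * s j : ℝ)))‖ = 1 := by
    rw [Complex.norm_exp]; simp
  rw [e, ← sub_one_mul, norm_mul, norm_mul, h1, one_mul, ← Complex.ofReal_one,
    ← Complex.ofReal_sub, Complex.norm_real]
  refine mul_le_mul_of_nonneg_right (Real.abs_exp_sub_one_le_exp_sub_one ?_) (norm_nonneg _)
  rw [hr, Finset.mul_sum]
  refine (Finset.abs_sum_le_sum_abs _ _).trans (Finset.sum_le_sum fun j _ => ?_)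
  rw [abs_neg, abs_mul, abs_of_pos hε]
  have h := abs_abs_sub_abs_le (t j + Real.log (y j)) (Real.log (y j))
  rw [add_sub_cancel_right] at h
  exact mul_le_mul_of_nonneg_left h hε.le

end PowerFunctions

section DiagonalAction

variable {n : ℕ}

theorem quasiMeasurePreserving_mulVec {M : Matrix (Fin n) (Fin n) ℝ} (hM : M.det ≠ 0) :
    Measure.QuasiMeasurePreserving (fun x : Fin n → ℝ => M *ᵥ x) volume volume := by
  refine ⟨Continuous.measurable (by fun_prop), ?_⟩
  have h := Real.map_matrix_volume_pi_eq_smul_volume_pi hM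
  change Measure.map (toLin' M) volume ≪ volume
  rw [h]
  exact Measure.smul_absolutelyContinuous

theorem ae_forall_mulVec_ne_zero {M : Matrix (Fin n) (Fin n) ℝ} (hM : M.det ≠ 0) :
    ∀ᵐ x : Fin n → ℝ, ∀ j, (M *ᵥ x) j ≠ 0 := by
  refine (quasiMeasurePreserving_mulVec hM).ae (p := fun y => ∀ j, y j ≠ 0) (ae_all_iff.2 fun j => ?_)
  have h : ∀ᵐ y : ℝ, y ≠ 0 := by simp [ae_iff]
  exact (Measure.quasiMeasurePreserving_eval (fun _ : Fin n => (volume : Measure ℝ)) j).ae h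

theorem lintegral_comp_mulVec {M : Matrix (Fin n) (Fin n) ℝ} (hM : M.det ≠ 0)
    {F : (Fin n → ℝ) → ℝ≥0∞} (hF : Measurable F) :
    ∫⁻ x, F (M *ᵥ x) = ENNReal.ofReal |M.det⁻¹| * ∫⁻ x, F x := by
  have h := Real.map_matrix_volume_pi_eq_smul_volume_pi hM
  rw [← smul_eq_mul, ← lintegral_smul_measure, ← h, lintegral_map hF (Continuous.measurable (by fun_prop))]
  rfl

theorem memLp_comp_mulVec {M : Matrix (Fin n) (Fin n) ℝ} (hM : M.det ≠ 0) {f : (Fin n → ℝ) → ℂ}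
    (hf : Measurable f) (hf2 : MemLp f 2) : MemLp (fun x => f (M *ᵥ x)) 2 := by
  refine memLp_two_of_lintegral_sq
    (hf.comp (quasiMeasurePreserving_mulVec hM).measurable) ?_
  rw [lintegral_comp_mulVec hM (F := fun x => ‖f x‖ₑ ^ 2) (by fun_prop), ← eLpNorm_two_sq]
  exact ENNReal.mul_lt_top ENNReal.ofReal_lt_top (ENNReal.pow_lt_top hf2.2)

/-- The dilations along the coordinate axes of the basis given by `C`. -/
noncomputable def diagonalAction (C : Matrix (Fin n) (Fin n) ℝ) (hC : IsUnit C.det) :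
    WeightedAction (EuclideanSpace ℝ (Fin n)) (volume : Measure (Fin n → ℝ)) where
  act t x := (C⁻¹ * diagonal (fun j => Real.exp (t j)) * C) *ᵥ x
  weight t := Real.exp ((∑ j, t j) / 2)
  measurable_act := by
    refine Continuous.measurable ?_
    fun_prop
  measurable_weight := by fun_prop
  act_zero x := by
    simp [Matrix.nonsing_inv_mul _ hC]
  act_add s t x := by
    rw [mulVec_mulVec]
    congr 1
    have e : diagonal (fun j => Real.exp ((s + t) j)) =
        diagonal (fun j => Real.exp (s j)) * diagonal (fun j => Real.exp (t j)) := by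
      simp [diagonal_mul_diagonal, Real.exp_add]
    rw [e]
    simp only [Matrix.mul_assoc, Matrix.mul_nonsing_inv_cancel_left _ _ hC]
  weight_pos t := Real.exp_pos _
  weight_add s t := by
    rw [← Real.exp_add]
    simp [Finset.sum_add_distrib, add_div]
  lintegral_act t F hF := by
    have hdet : (C⁻¹ * diagonal (fun j => Real.exp (t j)) * C).det = Real.exp (∑ j, t j) := by
      rw [det_mul, det_mul, det_diagonal, Real.exp_sum, mul_right_comm, ← det_mul,
        Matrix.nonsing_inv_mul _ hC, det_one, one_mul]
    rw [lintegral_const_mul' _ _ (ENNReal.pow_ne_top ENNReal.ofReal_ne_top),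
      lintegral_comp_mulVec (by rw [hdet]; exact Real.exp_ne_zero _) hF, hdet, ← mul_assoc,
      ← ENNReal.ofReal_pow (Real.exp_pos _).le, ← ENNReal.ofReal_mul (by positivity),
      ← Real.exp_nat_mul, ← Real.exp_neg, Real.abs_exp, ← Real.exp_add]
    simp [mul_div_cancel₀]

theorem mulVec_diagonalAction {C : Matrix (Fin n) (Fin n) ℝ} (hC : IsUnit C.det)
    (t : EuclideanSpace ℝ (Fin n)) (x : Fin n → ℝ) :
    C *ᵥ (diagonalAction C hC).act t x = fun j => Real.exp (t j) * (C *ᵥ x) j := by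
  change C *ᵥ (_ *ᵥ x) = _
  rw [mulVec_mulVec, ← Matrix.mul_assoc, Matrix.mul_nonsing_inv_cancel_left _ _ hC,
    ← mulVec_mulVec]
  ext j
  rw [mulVec_diagonal]

open RealInnerProductSpace in
theorem mem_spectrum_diagonalAction {C : Matrix (Fin n) (Fin n) ℝ} (hC : IsUnit C.det)
    {Ω : Type*} [MeasurableSpace Ω] {μ : Measure Ω} [SFinite μ] {c : Ω → ℂ}
    {τ : Ω → EuclideanSpace ℝ (Fin n)} (hc : Measurable c) (hci : Integrable c μ)
    (hτ : Measurable τ)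
    {T : Lp ℂ 2 (volume : Measure (Fin n → ℝ)) →L[ℂ] Lp ℂ 2 (volume : Measure (Fin n → ℝ))}
    (hT : ∀ f : Lp ℂ 2 (volume : Measure (Fin n → ℝ)),
      T f =ᵐ[volume] (diagonalAction C hC).avg μ c τ f) (s : EuclideanSpace ℝ (Fin n)) :
    ∫ u, c u * cexp (-(I * (⟪τ u, s⟫ : ℝ))) ∂μ ∈ spectrum ℂ T := by
  refine (diagonalAction C hC).mem_spectrum_of_forall_norm_comp_sub_le hc hci hτ hT
    (χ := fun t => cexp (-(I * (⟪t, s⟫ : ℝ)))) (by fun_prop)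
    (fun t => by rw [Complex.norm_exp]; simp)
    (N := fun t => ∑ j, |t j|) (by fun_prop) fun ε hε => ?_
  have hm : Measurable fun x : Fin n → ℝ => dampedPower ε s (C *ᵥ x) :=
    (measurable_dampedPower ε s).comp (quasiMeasurePreserving_mulVec hC.ne_zero).measurable
  refine ⟨fun x => dampedPower ε s (C *ᵥ x), hm,
    memLp_comp_mulVec hC.ne_zero (measurable_dampedPower ε s) (memLp_dampedPower hε s),
    fun h => ?_, fun t => ?_⟩
  · obtain ⟨x, hx⟩ := h.exists
    exact dampedPower_ne_zero _ _ _ hx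
  · filter_upwards [ae_forall_mulVec_ne_zero hC.ne_zero] with x hx
    have h := norm_dampedPower_sub_le hε s t _ hx
    have e : ∑ j, t j * s j = ⟪t, s⟫ := by
      simp [PiLp.inner_apply, mul_comm]
    rw [e] at h
    simp only [WeightedAction.comp, mulVec_diagonalAction]
    exact h

open RealInnerProductSpace in
theorem spectrum_eq_of_ae_eq_avg_diagonalAction {C : Matrix (Fin n) (Fin n) ℝ} (hC : IsUnit C.det)
    {Ω : Type*} [MeasurableSpace Ω] {μ : Measure Ω} [SFinite μ] {c : Ω → ℂ}
    {τ : Ω → EuclideanSpace ℝ (Fin n)} (hci : AEStronglyMeasurable c μ → Integrable c μ)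
    (hτ : Measurable τ)
    {T : Lp ℂ 2 (volume : Measure (Fin n → ℝ)) →L[ℂ] Lp ℂ 2 (volume : Measure (Fin n → ℝ))}
    (hT : ∀ f : Lp ℂ 2 (volume : Measure (Fin n → ℝ)),
      T f =ᵐ[volume] (diagonalAction C hC).avg μ c τ f) :
    spectrum ℂ T = closure (Set.range fun s : EuclideanSpace ℝ (Fin n) =>
      ∫ u, c u * cexp (-(I * (⟪τ u, s⟫ : ℝ))) ∂μ) := by
  by_cases hc : AEStronglyMeasurable c μ
  · have hmk := hc.ae_eq_mk
    have hmeas : Measurable (hc.mk c) := hc.stronglyMeasurable_mk.measurable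
    have hi : Integrable (hc.mk c) μ := (hci hc).congr hmk
    have hT' (f : Lp ℂ 2 (volume : Measure (Fin n → ℝ))) :
        T f =ᵐ[volume] (diagonalAction C hC).avg μ (hc.mk c) τ f := by
      refine (hT f).trans (Eventually.of_forall fun x => integral_congr_ae ?_)
      filter_upwards [hmk] with u hu
      rw [hu]
    have hsymb (s : EuclideanSpace ℝ (Fin n)) : ∫ u, c u * cexp (-(I * (⟪τ u, s⟫ : ℝ))) ∂μ =
        ∫ u, hc.mk c u * cexp (-(I * (⟪τ u, s⟫ : ℝ))) ∂μ := by
      refine integral_congr_ae ?_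
      filter_upwards [hmk] with u hu
      rw [hu]
    simp only [hsymb]
    refine ((diagonalAction C hC).spectrum_subset hmeas hi hτ hT').antisymm
      (closure_minimal ?_ (spectrum.isClosed T))
    rintro _ ⟨s, rfl⟩
    exact mem_spectrum_diagonalAction hC hmeas hi hτ hT' s
  · have hg := memLp_dampedPower zero_lt_one (0 : Fin n → ℝ)
    have hT0 := (diagonalAction C hC).eq_zero_of_not_aestronglyMeasurable hc hτ hT hg
      (dampedPower_ne_zero _ _)
    have hsymb (s : EuclideanSpace ℝ (Fin n)) :
        ∫ u, c u * cexp (-(I * (⟪τ u, s⟫ : ℝ))) ∂μ = 0 := by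
      refine integral_undef fun hi => hc ?_
      have hm : Measurable fun u => cexp (I * (⟪τ u, s⟫ : ℝ)) := by fun_prop
      refine (hi.1.mul hm.aestronglyMeasurable).congr (Eventually.of_forall fun u => ?_)
      simp only [Pi.mul_apply]
      rw [mul_assoc, ← Complex.exp_add, neg_add_cancel, Complex.exp_zero, mul_one]
    have : Nontrivial (Lp ℂ 2 (volume : Measure (Fin n → ℝ))) := by
      refine ⟨hg.toLp _, 0, fun h => ?_⟩
      have h1 : dampedPower 1 (0 : Fin n → ℝ) =ᵐ[volume] 0 :=
        hg.coeFn_toLp.symm.trans (by rw [h]; exact Lp.coeFn_zero _ _ _)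
      obtain ⟨x, hx⟩ := h1.exists
      exact dampedPower_ne_zero _ _ _ hx
    simp only [hsymb, hT0, spectrum.zero_eq, Set.range_const, closure_singleton]

end DiagonalAction

/-- The spectrum of a normal Hausdorff operator on `L²(ℝⁿ)` equals the closure of the range
of its symbol. -/
theorem hausdorff_spectrum {Ω : Type*} [MeasurableSpace Ω] (μ : Measure Ω)
    [SigmaFinite μ] (n : ℕ)
    (Φ : Ω → ℂ) (A : Ω → Matrix (Fin n) (Fin n) ℝ)
    (C : Matrix (Fin n) (Fin n) ℝ) (hC : C * Cᵀ = 1)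
    (a : Fin n → Ω → ℝ) (ha : ∀ j, Measurable (a j))
    (hapos : ∀ᵐ u ∂μ, Φ u ≠ 0 → ∀ j, 0 < a j u)
    (hdiag : ∀ᵐ u ∂μ, Φ u ≠ 0 → A u = C⁻¹ * Matrix.diagonal (fun j => a j u) * C)
    (hint : Integrable (fun u => ‖Φ u‖ * (∏ j, a j u) ^ (-((1 : ℝ) / 2))) μ)
    (T : Lp ℂ 2 (volume : Measure (Fin n → ℝ)) →L[ℂ] Lp ℂ 2 (volume : Measure (Fin n → ℝ)))
    (hT : ∀ f : Lp ℂ 2 (volume : Measure (Fin n → ℝ)),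
      ∀ᵐ x : Fin n → ℝ ∂volume, T f x = ∫ u, Φ u * f ((A u).mulVec x) ∂μ)
    (φ : (Fin n → ℝ) → ℂ)
    (hφ : ∀ s : Fin n → ℝ,
      φ s = ∫ u, Φ u * ∏ j, (a j u : ℂ) ^ (-(1 / 2 : ℂ) - Complex.I * (s j : ℂ)) ∂μ) :
    spectrum ℂ T = closure (Set.range φ) := by
  have hCu : IsUnit C.det :=
    isUnit_of_mul_isUnit_left (by rw [← det_mul, hC, det_one]; exact isUnit_one)
  set τ : Ω → EuclideanSpace ℝ (Fin n) := fun u => WithLp.toLp 2 fun j => Real.log (a j u) with hτ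
  have hτm : Measurable τ := by fun_prop
  set c : Ω → ℂ := fun u => Φ u * (Real.exp (-((∑ j, Real.log (a j u)) / 2)) : ℝ) with hc
  have hci (h : AEStronglyMeasurable c μ) : Integrable c μ := by
    refine (integrable_norm_iff h).1 (hint.congr ?_)
    filter_upwards [hapos] with u hu
    by_cases h0 : Φ u = 0
    · simp [hc, h0]
    · have hu := hu h0
      rw [hc, norm_mul, Complex.norm_real, Real.norm_eq_abs, Real.abs_exp,
        Real.rpow_def_of_pos (Finset.prod_pos fun j _ => hu j),
        Real.log_prod fun j _ => (hu j).ne']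
      ring_nf
  have hT' (f : Lp ℂ 2 (volume : Measure (Fin n → ℝ))) :
      T f =ᵐ[volume] (diagonalAction C hCu).avg μ c τ f := by
    filter_upwards [hT f] with x hx
    rw [hx]
    refine integral_congr_ae ?_
    filter_upwards [hapos, hdiag] with u hu hA
    by_cases h0 : Φ u = 0
    · simp [hc, h0]
    · have hu := hu h0
      have e : (diagonalAction C hCu).act (τ u) x = A u *ᵥ x := by
        simp only [diagonalAction, hτ, Real.exp_log (hu _), hA h0]
      have ew : (diagonalAction C hCu).weight (τ u) = Real.exp ((∑ j, Real.log (a j u)) / 2) := rfl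
      rw [WeightedAction.comp, e, ew, ← mul_assoc]
      simp only [hc]
      rw [mul_assoc (Φ u), ← Complex.ofReal_mul, ← Real.exp_add, neg_add_cancel, Real.exp_zero,
        Complex.ofReal_one, mul_one]
  have hφ' (s : EuclideanSpace ℝ (Fin n)) :
      ∫ u, c u * cexp (-(I * (inner ℝ (τ u) s : ℝ))) ∂μ = φ s := by
    rw [hφ]
    refine integral_congr_ae ?_
    filter_upwards [hapos] with u hu
    by_cases h0 : Φ u = 0
    · simp [hc, h0]
    · have hu := hu h0
      simp only [hc]
      rw [mul_assoc, Complex.ofReal_exp, ← Complex.exp_add]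
      congr 1
      have e (j : Fin n) : (a j u : ℂ) ^ (-(1 / 2 : ℂ) - I * (s j : ℂ)) =
          cexp (Real.log (a j u) * (-(1 / 2 : ℂ) - I * (s j : ℂ))) := by
        rw [Complex.cpow_def_of_ne_zero (Complex.ofReal_ne_zero.2 (hu j).ne'),
          Complex.ofReal_log (hu j).le]
      simp only [e]
      rw [← Complex.exp_sum]
      congr 1
      simp only [hτ, PiLp.inner_apply, RCLike.inner_apply, conj_trivial]
      push_cast
      rw [Finset.sum_div, Finset.mul_sum, ← Finset.sum_neg_distrib, ← Finset.sum_neg_distrib,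
        ← Finset.sum_add_distrib]
      refine Finset.sum_congr rfl fun j _ => ?_
      ring
  rw [spectrum_eq_of_ae_eq_avg_diagonalAction hCu hci hτm hT']
  simp only [hφ']
  congr 1
  ext z
  exact ⟨fun ⟨s, hs⟩ => ⟨s, hs⟩, fun ⟨s, hs⟩ => ⟨WithLp.toLp 2 s, hs⟩⟩
end

section
/- Under the hypotheses of Theorem 1 (A(u) = C⁻¹ diag(a_1(u),…,a_n(u)) C with C orthogonal and a_j(u) > 0 μ-measurable, u ↦ |Φ(u)|(a_1(u)⋯a_n(u))^{-1/2} μ-integrable, T a continuous linear operator on L²(ℝⁿ;ℂ) realizing H_{Φ,A}), the residual spectrum of T is empty: for every λ ∈ ℂ, if T − λ·I is injective then the range of T − λ·I is dense in L²(ℝⁿ;ℂ). -/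
open MeasureTheory Complex Filter Matrix
open scoped ENNReal ComplexConjugate

/-- The matrix `C⁻¹ diag(exp s) C`. -/
noncomputable def dilationMatrix {n : ℕ} (C : Matrix (Fin n) (Fin n) ℝ) (s : Fin n → ℝ) :
    Matrix (Fin n) (Fin n) ℝ :=
  C⁻¹ * Matrix.diagonal (fun j => Real.exp (s j)) * C

section Dilation

variable {n : ℕ} {C : Matrix (Fin n) (Fin n) ℝ}

theorem dilationMatrix_zero (hC : IsUnit C.det) : dilationMatrix C 0 = 1 := by
  simp [dilationMatrix, Matrix.nonsing_inv_mul C hC]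

theorem dilationMatrix_add (hC : IsUnit C.det) (s t : Fin n → ℝ) :
    dilationMatrix C (s + t) = dilationMatrix C s * dilationMatrix C t := by
  have h : Matrix.diagonal (fun j => Real.exp ((s + t) j)) =
      Matrix.diagonal (fun j => Real.exp (s j)) * Matrix.diagonal (fun j => Real.exp (t j)) := by
    simp [Matrix.diagonal_mul_diagonal, Real.exp_add]
  simp only [dilationMatrix, h, Matrix.mul_assoc]
  rw [← Matrix.mul_assoc C C⁻¹, Matrix.mul_nonsing_inv C hC, Matrix.one_mul]

theorem det_dilationMatrix (hC : IsUnit C.det) (s : Fin n → ℝ) :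
    (dilationMatrix C s).det = Real.exp (∑ j, s j) := by
  have h : (C⁻¹).det * C.det = 1 := by
    rw [← Matrix.det_mul, Matrix.nonsing_inv_mul C hC, Matrix.det_one]
  rw [dilationMatrix, Matrix.det_mul, Matrix.det_mul, Matrix.det_diagonal, Real.exp_sum,
    mul_right_comm, h, one_mul]

theorem continuous_dilationMatrix_mulVec :
    Continuous (fun p : (Fin n → ℝ) × (Fin n → ℝ) => (dilationMatrix C p.1).mulVec p.2) := by
  unfold dilationMatrix
  fun_prop

theorem measurable_dilationMatrix_mulVec (s : Fin n → ℝ) :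
    Measurable (fun x => (dilationMatrix C s).mulVec x) :=
  (continuous_dilationMatrix_mulVec.comp (Continuous.prodMk_right s)).measurable

theorem map_dilationMatrix_mulVec_volume (hC : IsUnit C.det) (s : Fin n → ℝ) :
    Measure.map (fun x => (dilationMatrix C s).mulVec x) volume =
      ENNReal.ofReal (Real.exp (-∑ j, s j)) • (volume : Measure (Fin n → ℝ)) := by
  have h := Real.map_matrix_volume_pi_eq_smul_volume_pi (M := dilationMatrix C s)
    (by rw [det_dilationMatrix hC]; positivity)
  rw [det_dilationMatrix hC, ← Real.exp_neg, abs_of_pos (Real.exp_pos _)] at h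
  exact h

theorem quasiMeasurePreserving_dilationMatrix (hC : IsUnit C.det) (s : Fin n → ℝ) :
    Measure.QuasiMeasurePreserving (fun x => (dilationMatrix C s).mulVec x)
      (volume : Measure (Fin n → ℝ)) volume := by
  refine ⟨measurable_dilationMatrix_mulVec s, ?_⟩
  rw [map_dilationMatrix_mulVec_volume hC]
  exact Measure.smul_absolutelyContinuous

/-- The unimodular dilation `x ↦ det(M)^{1/2} f(M x)` with `M = C⁻¹ diag(exp s) C`. -/
noncomputable def dilate (C : Matrix (Fin n) (Fin n) ℝ) (s : Fin n → ℝ) (f : (Fin n → ℝ) → ℂ) :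
    (Fin n → ℝ) → ℂ :=
  fun x => (Real.exp ((∑ j, s j) / 2) : ℂ) * f ((dilationMatrix C s).mulVec x)

theorem eLpNorm_dilate (hC : IsUnit C.det) (s : Fin n → ℝ) {f : (Fin n → ℝ) → ℂ}
    (hf : StronglyMeasurable f) : eLpNorm (dilate C s f) 2 volume = eLpNorm f 2 volume := by
  have h1 : dilate C s f = (Real.exp ((∑ j, s j) / 2) : ℂ) •
      (f ∘ fun x => (dilationMatrix C s).mulVec x) := rfl
  rw [h1, eLpNorm_const_smul, ← eLpNorm_map_measure hf.aestronglyMeasurable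
    (measurable_dilationMatrix_mulVec s).aemeasurable, map_dilationMatrix_mulVec_volume hC,
    eLpNorm_smul_measure_of_ne_top (by simp), smul_eq_mul, ← mul_assoc]
  convert one_mul _
  rw [← ofReal_norm, Complex.norm_real, Real.norm_of_nonneg (Real.exp_pos _).le,
    ENNReal.ofReal_rpow_of_pos (Real.exp_pos _), ← ENNReal.ofReal_mul (Real.exp_pos _).le,
    ← Real.exp_mul, ← Real.exp_add]
  simp
  ring

theorem memLp_dilate (hC : IsUnit C.det) (s : Fin n → ℝ) {f : (Fin n → ℝ) → ℂ}
    (hf : StronglyMeasurable f) (hf2 : MemLp f 2 volume) : MemLp (dilate C s f) 2 volume :=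
  ⟨((hf.comp_measurable (measurable_dilationMatrix_mulVec s)).const_mul _).aestronglyMeasurable,
    by rw [eLpNorm_dilate hC s hf]; exact hf2.2⟩

theorem dilate_congr_ae (hC : IsUnit C.det) (s : Fin n → ℝ) {f g : (Fin n → ℝ) → ℂ}
    (h : f =ᵐ[volume] g) : dilate C s f =ᵐ[volume] dilate C s g := by
  filter_upwards [(quasiMeasurePreserving_dilationMatrix hC s).ae h] with x hx
  simp only [dilate, hx]

theorem dilate_dilate (hC : IsUnit C.det) (s t : Fin n → ℝ) (f : (Fin n → ℝ) → ℂ) :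
    dilate C s (dilate C t f) = dilate C (s + t) f := by
  funext x
  have h : Real.exp ((∑ j, (s + t) j) / 2) =
      Real.exp ((∑ j, s j) / 2) * Real.exp ((∑ j, t j) / 2) := by
    rw [← Real.exp_add, ← add_div, ← Finset.sum_add_distrib]; rfl
  rw [dilate, dilate, dilate, h, add_comm, dilationMatrix_add hC, Matrix.mulVec_mulVec]
  push_cast
  ring

/-- Unimodular dilation as a linear isometry of `L²(ℝⁿ)`. -/
noncomputable def dilationIsometry (hC : IsUnit C.det) (s : Fin n → ℝ) :
    Lp ℂ 2 (volume : Measure (Fin n → ℝ)) →ₗᵢ[ℂ] Lp ℂ 2 (volume : Measure (Fin n → ℝ)) where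
  toFun f := (memLp_dilate hC s (Lp.stronglyMeasurable f) (Lp.memLp f)).toLp _
  map_add' f g := by
    apply Lp.ext
    refine (MemLp.coeFn_toLp _).trans ?_
    refine (dilate_congr_ae hC s (Lp.coeFn_add f g)).trans ?_
    refine .trans ?_ (Lp.coeFn_add _ _).symm
    filter_upwards [MemLp.coeFn_toLp (memLp_dilate hC s (Lp.stronglyMeasurable f) (Lp.memLp f)),
      MemLp.coeFn_toLp (memLp_dilate hC s (Lp.stronglyMeasurable g) (Lp.memLp g))] with x h1 h2
    simp only [Pi.add_apply, h1, h2, dilate, mul_add]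
  map_smul' c f := by
    apply Lp.ext
    refine (MemLp.coeFn_toLp _).trans ?_
    refine (dilate_congr_ae hC s (Lp.coeFn_smul c f)).trans ?_
    refine .trans ?_ (Lp.coeFn_smul _ _).symm
    filter_upwards [MemLp.coeFn_toLp (memLp_dilate hC s (Lp.stronglyMeasurable f) (Lp.memLp f))]
      with x h1
    simp only [Pi.smul_apply, RingHom.id_apply, h1, dilate, smul_eq_mul]
    ring
  norm_map' f := by
    simp only [LinearMap.coe_mk, AddHom.coe_mk]
    rw [Lp.norm_toLp, eLpNorm_dilate hC s (Lp.stronglyMeasurable f), Lp.norm_def]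

theorem coeFn_dilationIsometry (hC : IsUnit C.det) (s : Fin n → ℝ)
    (f : Lp ℂ 2 (volume : Measure (Fin n → ℝ))) :
    dilationIsometry hC s f =ᵐ[volume] dilate C s f :=
  MemLp.coeFn_toLp (memLp_dilate hC s (Lp.stronglyMeasurable f) (Lp.memLp f))

theorem dilationIsometry_dilationIsometry (hC : IsUnit C.det) (s t : Fin n → ℝ)
    (f : Lp ℂ 2 (volume : Measure (Fin n → ℝ))) :
    dilationIsometry hC s (dilationIsometry hC t f) = dilationIsometry hC (s + t) f := by
  apply Lp.ext
  refine (coeFn_dilationIsometry hC s _).trans ?_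
  refine (dilate_congr_ae hC s (coeFn_dilationIsometry hC t f)).trans ?_
  rw [dilate_dilate hC]
  exact (coeFn_dilationIsometry hC _ f).symm

theorem dilationIsometry_zero (hC : IsUnit C.det) (f : Lp ℂ 2 (volume : Measure (Fin n → ℝ))) :
    dilationIsometry hC 0 f = f := by
  apply Lp.ext
  refine (coeFn_dilationIsometry hC 0 f).trans (.of_forall fun x => ?_)
  simp [dilate, dilationMatrix_zero hC]

theorem adjoint_dilationIsometry (hC : IsUnit C.det) (s : Fin n → ℝ) :
    ContinuousLinearMap.adjoint (dilationIsometry hC s).toContinuousLinearMap =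
      (dilationIsometry hC (-s)).toContinuousLinearMap := by
  symm
  rw [ContinuousLinearMap.eq_adjoint_iff]
  intro f g
  rw [← (dilationIsometry hC s).inner_map_map]
  simp [dilationIsometry_dilationIsometry, dilationIsometry_zero]

theorem commute_dilationIsometry (hC : IsUnit C.det) (s t : Fin n → ℝ) :
    Commute (dilationIsometry hC s).toContinuousLinearMap
      (dilationIsometry hC t).toContinuousLinearMap := by
  ext1 f
  simp [dilationIsometry_dilationIsometry, add_comm]

end Dilation

section WeakIntegral

variable {Ω H : Type*} [MeasurableSpace Ω] {μ : Measure Ω} [NormedAddCommGroup H]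
  [InnerProductSpace ℂ H] [CompleteSpace H] {φ : Ω → ℂ} {U : Ω → H →L[ℂ] H} {T : H →L[ℂ] H}

theorem commute_of_inner_eq_integral
    (hT : ∀ f g, inner ℂ g (T f) = ∫ u, φ u * inner ℂ g (U u f) ∂μ)
    {B : H →L[ℂ] H} (hB : ∀ u, Commute (U u) B) : Commute T B := by
  ext1 f
  refine ext_inner_left ℂ fun g => ?_
  have h (u) : U u (B f) = B (U u f) := DFunLike.congr_fun (hB u).eq f
  simp only [mul_apply_eq_comp, hT, h]
  simp only [← ContinuousLinearMap.adjoint_inner_left B, hT]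

/-- A weak integral of a family of operators that commute with each other's adjoints is normal. -/
theorem isStarNormal_of_inner_eq_integral
    (hT : ∀ f g, inner ℂ g (T f) = ∫ u, φ u * inner ℂ g (U u f) ∂μ)
    (hU : ∀ u v, Commute (U u) (star (U v))) :
    IsStarNormal T := by
  have h (u) : Commute (U u) (star T) := by
    have h := (commute_of_inner_eq_integral hT fun v => hU v u).star_star
    rw [_root_.star_star] at h
    exact h.symm
  exact ⟨(commute_of_inner_eq_integral hT h).symm⟩

theorem denseRange_sub_smul_one_of_isStarNormal (hT : IsStarNormal T) (l : ℂ)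
    (hinj : Function.Injective ⇑(T - l • (1 : H →L[ℂ] H))) :
    DenseRange ⇑(T - l • (1 : H →L[ℂ] H)) := by
  have hN : IsStarNormal (T - l • (1 : H →L[ℂ] H)) := by
    refine ⟨?_⟩
    have h1 (c : ℂ) (B : H →L[ℂ] H) : Commute B (c • (1 : H →L[ℂ] H)) :=
      (Commute.one_right B).smul_right c
    rw [star_sub, star_smul, star_one]
    exact (hT.star_comm_self.sub_right (h1 _ _)).sub_left ((h1 _ _).symm.sub_right (h1 _ _))
  have h := ContinuousLinearMap.IsStarNormal.orthogonal_range hN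
  rw [LinearMap.ker_eq_bot.2 hinj, ← Submodule.topologicalClosure_eq_top_iff] at h
  exact (Submodule.dense_iff_topologicalClosure_eq_top).2 h

end WeakIntegral

section Realization

variable {Ω : Type*} [MeasurableSpace Ω] {μ : Measure Ω} [SigmaFinite μ] {n : ℕ}
  {C : Matrix (Fin n) (Fin n) ℝ} {s : Ω → Fin n → ℝ} {Φ : Ω → ℂ}

theorem stronglyMeasurable_comp_dilationMatrix_mulVec (hs : Measurable s)
    {f : (Fin n → ℝ) → ℂ} (hf : StronglyMeasurable f) :
    StronglyMeasurable fun p : (Fin n → ℝ) × Ω => f ((dilationMatrix C (s p.2)).mulVec p.1) := by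
  have h1 : Measurable fun p : (Fin n → ℝ) × Ω => (s p.2, p.1) :=
    (hs.comp measurable_snd).prodMk measurable_fst
  have h2 : Measurable fun p : (Fin n → ℝ) × Ω => (dilationMatrix C (s p.2)).mulVec p.1 := by
    have h := Measurable.comp (continuous_dilationMatrix_mulVec (C := C)).measurable h1
    simpa only [Function.comp_def] using h
  exact hf.comp_measurable h2

theorem integrable_prod_mul_comp_dilationMatrix (hC : IsUnit C.det) (hs : Measurable s)
    (hΦ : AEStronglyMeasurable Φ μ)
    (hint : Integrable (fun u => ‖Φ u‖ * Real.exp (-((∑ j, s u j) / 2))) μ)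
    (f g : Lp ℂ 2 (volume : Measure (Fin n → ℝ))) :
    Integrable (fun p : (Fin n → ℝ) × Ω =>
      Φ p.2 * f ((dilationMatrix C (s p.2)).mulVec p.1) * conj (g p.1)) (volume.prod μ) := by
  have hmeas : AEStronglyMeasurable (fun p : (Fin n → ℝ) × Ω =>
      Φ p.2 * f ((dilationMatrix C (s p.2)).mulVec p.1) * conj (g p.1)) (volume.prod μ) :=
    (hΦ.comp_snd.mul (stronglyMeasurable_comp_dilationMatrix_mulVec hs
      (Lp.stronglyMeasurable f)).aestronglyMeasurable).mul
      (Complex.continuous_conj.comp_stronglyMeasurable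
        ((Lp.stronglyMeasurable g).comp_measurable measurable_fst)).aestronglyMeasurable
  have hsq (h : Lp ℂ 2 (volume : Measure (Fin n → ℝ))) :
      Integrable (fun x => ‖h x‖ ^ 2) volume :=
    (memLp_two_iff_integrable_sq_norm (Lp.aestronglyMeasurable h)).1 (Lp.memLp h)
  have hsqn (h : Lp ℂ 2 (volume : Measure (Fin n → ℝ))) : ∫ x, ‖h x‖ ^ 2 = ‖h‖ ^ 2 := by
    have h1 := L2.inner_def (𝕜 := ℂ) h h
    simp only [inner_self_eq_norm_sq_to_K, Complex.coe_algebraMap] at h1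
    exact_mod_cast h1.symm
  have hbd (u : Ω) : ∀ᵐ x, ‖Φ u * f ((dilationMatrix C (s u)).mulVec x) * conj (g x)‖ ≤
      ‖Φ u‖ * Real.exp (-((∑ j, s u j) / 2)) *
        (‖dilationIsometry hC (s u) f x‖ ^ 2 + ‖g x‖ ^ 2) := by
    filter_upwards [coeFn_dilationIsometry hC (s u) f] with x hx
    have h1 : ‖f ((dilationMatrix C (s u)).mulVec x)‖ =
        Real.exp (-((∑ j, s u j) / 2)) * ‖dilationIsometry hC (s u) f x‖ := by
      rw [hx, dilate, norm_mul, Complex.norm_real, Real.norm_of_nonneg (Real.exp_pos _).le,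
        ← mul_assoc, ← Real.exp_add]
      simp
    rw [norm_mul, norm_mul, h1, RCLike.norm_conj, ← mul_assoc, mul_assoc (_ * _)]
    gcongr
    nlinarith [sq_nonneg (‖dilationIsometry hC (s u) f x‖ - ‖g x‖),
      sq_nonneg (‖dilationIsometry hC (s u) f x‖), sq_nonneg ‖g x‖]
  have hbdi (u : Ω) := ((hsq (dilationIsometry hC (s u) f)).add (hsq g)).const_mul
    (‖Φ u‖ * Real.exp (-((∑ j, s u j) / 2)))
  have hsec (u : Ω) : AEStronglyMeasurable
      (fun x => Φ u * f ((dilationMatrix C (s u)).mulVec x) * conj (g x)) volume :=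
    ((((Lp.stronglyMeasurable f).comp_measurable
      (measurable_dilationMatrix_mulVec (s u))).const_mul _).mul
      (Complex.continuous_conj.comp_stronglyMeasurable (Lp.stronglyMeasurable g))
      ).aestronglyMeasurable
  rw [integrable_prod_iff' hmeas]
  refine ⟨.of_forall fun u => (hbdi u).mono' (hsec u) (hbd u), ?_⟩
  refine (hint.mul_const (‖f‖ ^ 2 + ‖g‖ ^ 2)).mono' hmeas.norm.prod_swap.integral_prod_right'
    (.of_forall fun u => ?_)
  rw [Real.norm_of_nonneg (integral_nonneg fun _ => norm_nonneg _)]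
  refine (integral_mono_ae ((hbdi u).mono' (hsec u) (hbd u)).norm (hbdi u) (hbd u)).trans_eq ?_
  simp only [Pi.add_apply]
  rw [integral_const_mul, integral_add (hsq _) (hsq g), hsqn, hsqn, LinearIsometry.norm_map]

theorem inner_eq_integral_of_realizes (hC : IsUnit C.det) (hs : Measurable s)
    (hΦ : AEStronglyMeasurable Φ μ)
    (hint : Integrable (fun u => ‖Φ u‖ * Real.exp (-((∑ j, s u j) / 2))) μ)
    {T : Lp ℂ 2 (volume : Measure (Fin n → ℝ)) →L[ℂ] Lp ℂ 2 (volume : Measure (Fin n → ℝ))}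
    (hT : ∀ f : Lp ℂ 2 (volume : Measure (Fin n → ℝ)),
      ∀ᵐ x, T f x = ∫ u, Φ u * f ((dilationMatrix C (s u)).mulVec x) ∂μ)
    (f g : Lp ℂ 2 (volume : Measure (Fin n → ℝ))) :
    inner ℂ g (T f) = ∫ u, (Φ u * Real.exp (-((∑ j, s u j) / 2)) : ℂ) *
      inner ℂ g ((dilationIsometry hC (s u)).toContinuousLinearMap f) ∂μ := by
  have h1 : inner ℂ g (T f) =
      ∫ x, ∫ u, Φ u * f ((dilationMatrix C (s u)).mulVec x) * conj (g x) ∂μ := by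
    rw [L2.inner_def]
    refine integral_congr_ae ?_
    filter_upwards [hT f] with x hx
    rw [RCLike.inner_apply, hx, integral_mul_const]
  rw [h1, integral_integral_swap (integrable_prod_mul_comp_dilationMatrix hC hs hΦ hint f g)]
  congr 1 with u
  rw [L2.inner_def, ← integral_const_mul]
  refine integral_congr_ae ?_
  filter_upwards [coeFn_dilationIsometry hC (s u) f] with x hx
  rw [LinearIsometry.coe_toContinuousLinearMap, RCLike.inner_apply, hx, dilate]
  have h2 : (Real.exp (-((∑ j, s u j) / 2)) : ℂ) * (Real.exp ((∑ j, s u j) / 2) : ℂ) = 1 := by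
    rw [← Complex.ofReal_mul, ← Real.exp_add]
    simp
  linear_combination (-(Φ u * f ((dilationMatrix C (s u)).mulVec x) * conj (g x))) * h2

theorem exists_Lp_two_forall_ne_zero {X : Type*} [MeasurableSpace X] (ν : Measure X)
    [SigmaFinite ν] : ∃ g : Lp ℂ 2 ν, ∀ᵐ x ∂ν, g x ≠ 0 := by
  obtain ⟨g, hpos, hg, hlt⟩ := exists_pos_lintegral_lt_of_sigmaFinite ν one_ne_zero
  have hm : Measurable fun x => ((Real.sqrt (g x) : ℝ) : ℂ) := by fun_prop
  have hL : MemLp (fun x => ((Real.sqrt (g x) : ℝ) : ℂ)) 2 ν := by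
    rw [memLp_two_iff_integrable_sq_norm hm.aestronglyMeasurable]
    have h (x) : ‖((Real.sqrt (g x) : ℝ) : ℂ)‖ ^ 2 = g x := by
      rw [Complex.norm_real, Real.norm_of_nonneg (Real.sqrt_nonneg _),
        Real.sq_sqrt (g x).coe_nonneg]
    simp only [h]
    refine ⟨hg.coe_nnreal_real.aestronglyMeasurable, ?_⟩
    simpa [HasFiniteIntegral] using hlt.trans ENNReal.one_lt_top
  refine ⟨hL.toLp _, ?_⟩
  filter_upwards [hL.coeFn_toLp] with x hx
  rw [hx]
  simpa [Real.sqrt_eq_zero'] using (hpos x).ne'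

/-- Every `L²` function differs from an a.e. nonvanishing one by a multiple of a given
a.e. nonvanishing one. -/
theorem exists_add_smul_ne_zero {X : Type*} [MeasurableSpace X] {ν : Measure X}
    [SigmaFinite ν] (f g : Lp ℂ 2 ν) (hg : ∀ᵐ x ∂ν, g x ≠ 0) :
    ∃ c : ℂ, ∀ᵐ x ∂ν, (f + c • g : Lp ℂ 2 ν) x ≠ 0 := by
  have hm : Measurable fun x => -f x / g x :=
    (Lp.stronglyMeasurable f).measurable.neg.div (Lp.stronglyMeasurable g).measurable
  obtain ⟨c, hc⟩ : ∃ c : ℂ, ν {x | -f x / g x = c} = 0 := by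
    have h := Measure.countable_meas_level_set_pos (μ := ν) hm
    obtain ⟨c, hc⟩ := (Set.Countable.dense_compl ℝ h).nonempty
    exact ⟨c, by simpa using hc⟩
  refine ⟨c, ?_⟩
  filter_upwards [hg, measure_eq_zero_iff_ae_notMem.1 hc, Lp.coeFn_add f (c • g),
    Lp.coeFn_smul c g] with x h1 h2 h3 h4 h5
  rw [h3, Pi.add_apply, h4, Pi.smul_apply, smul_eq_mul] at h5
  refine h2 ?_
  rw [div_eq_iff h1]
  linear_combination -h5

/-- If the kernel is not measurable, then the Bochner integrals vanish for every a.e. nonvanishing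
`f`, and these span `L²`. -/
theorem eq_zero_of_not_aestronglyMeasurable (hC : IsUnit C.det) (hs : Measurable s)
    (hΦ : ¬ AEStronglyMeasurable Φ μ)
    {T : Lp ℂ 2 (volume : Measure (Fin n → ℝ)) →L[ℂ] Lp ℂ 2 (volume : Measure (Fin n → ℝ))}
    (hT : ∀ f : Lp ℂ 2 (volume : Measure (Fin n → ℝ)),
      ∀ᵐ x, T f x = ∫ u, Φ u * f ((dilationMatrix C (s u)).mulVec x) ∂μ) :
    T = 0 := by
  have key (f : Lp ℂ 2 (volume : Measure (Fin n → ℝ))) (hf : ∀ᵐ x, f x ≠ 0) : T f = 0 := by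
    have hm := stronglyMeasurable_comp_dilationMatrix_mulVec (C := C) hs (Lp.stronglyMeasurable f)
    have h1 : ∀ᵐ x, ∀ᵐ u ∂μ, f ((dilationMatrix C (s u)).mulVec x) ≠ 0 := by
      have hset : MeasurableSet {p : (Fin n → ℝ) × Ω |
          f ((dilationMatrix C (s p.2)).mulVec p.1) ≠ 0} :=
        hm.measurable (measurableSet_singleton 0).compl
      rw [Measure.ae_ae_comm
        (p := fun x u => f ((dilationMatrix C (s u)).mulVec x) ≠ 0) hset]
      exact .of_forall fun u => (quasiMeasurePreserving_dilationMatrix hC (s u)).ae hf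
    apply Lp.ext
    filter_upwards [h1, hT f, Lp.coeFn_zero ℂ 2 (volume : Measure (Fin n → ℝ))] with x hx hTx h0
    rw [hTx, h0, Pi.zero_apply]
    refine integral_non_aestronglyMeasurable fun hmeas => hΦ ?_
    have hmx : Measurable fun u => f ((dilationMatrix C (s u)).mulVec x) := by
      have h := Measurable.comp hm.measurable (measurable_prodMk_left (x := x))
      simpa only [Function.comp_def] using h
    refine (hmeas.mul hmx.inv.aestronglyMeasurable).congr ?_
    filter_upwards [hx] with u hu
    simp [hu]
  obtain ⟨g, hg⟩ := exists_Lp_two_forall_ne_zero (volume : Measure (Fin n → ℝ))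
  ext1 f
  obtain ⟨c, hc⟩ := exists_add_smul_ne_zero f g hg
  have h := key _ hc
  rwa [map_add, map_smul, key g hg, smul_zero, add_zero] at h

theorem isStarNormal_of_realizes (hC : IsUnit C.det) (hs : Measurable s)
    (hint : Integrable (fun u => ‖Φ u‖ * Real.exp (-((∑ j, s u j) / 2))) μ)
    {T : Lp ℂ 2 (volume : Measure (Fin n → ℝ)) →L[ℂ] Lp ℂ 2 (volume : Measure (Fin n → ℝ))}
    (hT : ∀ f : Lp ℂ 2 (volume : Measure (Fin n → ℝ)),
      ∀ᵐ x, T f x = ∫ u, Φ u * f ((dilationMatrix C (s u)).mulVec x) ∂μ) :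
    IsStarNormal T := by
  by_cases hΦ : AEStronglyMeasurable Φ μ
  · refine isStarNormal_of_inner_eq_integral
      (inner_eq_integral_of_realizes hC hs hΦ hint hT)
      fun u v => ?_
    rw [ContinuousLinearMap.star_eq_adjoint, adjoint_dilationIsometry]
    exact commute_dilationIsometry hC _ _
  · rw [eq_zero_of_not_aestronglyMeasurable hC hs hΦ hT]
    exact .zero

end Realization

/-- The residual spectrum of a normal Hausdorff operator on `L²(ℝⁿ)` is empty: whenever
`T - λ·I` is injective, its range is dense. -/
theorem hausdorff_residual_spectrum_empty {Ω : Type*} [MeasurableSpace Ω] (μ : Measure Ω)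
    [SigmaFinite μ] (n : ℕ)
    (Φ : Ω → ℂ) (A : Ω → Matrix (Fin n) (Fin n) ℝ)
    (C : Matrix (Fin n) (Fin n) ℝ) (hC : C * Cᵀ = 1)
    (a : Fin n → Ω → ℝ) (ha : ∀ j, Measurable (a j))
    (hapos : ∀ᵐ u ∂μ, Φ u ≠ 0 → ∀ j, 0 < a j u)
    (hdiag : ∀ᵐ u ∂μ, Φ u ≠ 0 → A u = C⁻¹ * Matrix.diagonal (fun j => a j u) * C)
    (hint : Integrable (fun u => ‖Φ u‖ * (∏ j, a j u) ^ (-((1 : ℝ) / 2))) μ)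
    (T : Lp ℂ 2 (volume : Measure (Fin n → ℝ)) →L[ℂ] Lp ℂ 2 (volume : Measure (Fin n → ℝ)))
    (hT : ∀ f : Lp ℂ 2 (volume : Measure (Fin n → ℝ)),
      ∀ᵐ x : Fin n → ℝ ∂volume, T f x = ∫ u, Φ u * f ((A u).mulVec x) ∂μ) :
    ∀ l : ℂ, Function.Injective
        ⇑(T - l • (1 : Lp ℂ 2 (volume : Measure (Fin n → ℝ)) →L[ℂ]
            Lp ℂ 2 (volume : Measure (Fin n → ℝ)))) →
      DenseRange ⇑(T - l • (1 : Lp ℂ 2 (volume : Measure (Fin n → ℝ)) →L[ℂ]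
            Lp ℂ 2 (volume : Measure (Fin n → ℝ)))) := by
  intro l hinj
  have hdet : IsUnit C.det := Matrix.isUnit_det_of_right_inverse hC
  have hs : Measurable fun u j => Real.log (a j u) :=
    measurable_pi_lambda _ fun j => (ha j).log
  refine denseRange_sub_smul_one_of_isStarNormal
    (isStarNormal_of_realizes (μ := μ) (Φ := Φ) hdet hs ?_ fun f => ?_) l hinj
  · refine hint.congr ?_
    filter_upwards [hapos] with u hu
    by_cases h0 : Φ u = 0
    · simp [h0]
    · have hpos := hu h0
      rw [Real.rpow_def_of_pos (Finset.prod_pos fun j _ => hpos j),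
        Real.log_prod fun j _ => (hpos j).ne']
      ring_nf
  · filter_upwards [hT f] with x hx
    rw [hx]
    refine integral_congr_ae ?_
    filter_upwards [hapos, hdiag] with u hu hA
    by_cases h0 : Φ u = 0
    · simp [h0]
    · simp only [hA h0, dilationMatrix, Real.exp_log (hu h0 _)]
end
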